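/- In Grimmett's random-orientation model on Z² with parameter 1/2, there is almost surely no infinite directed path from the origin: θ_G(1/2) = 0. -/

import Mathlib

open MeasureTheory ENNReal

namespace RandomOrientation

/-- One step of the base-`(p, 1-p)` expansion map on `[0,1)`. -/
noncomputable def expand (p x : ℝ) : ℝ := if x < p then x / p else (x - p) / (1 - p)

/-- The `n`-th digit of the Bernoulli(`p`) expansion of `x`: for `x` uniformly
distributed on `[0,1)` the digits are i.i.d. `{true, false}`-valued with
`P(true) = p`. -/
noncomputable def bernDigit (p : ℝ) (n : ℕ) (x : ℝ) : Bool :=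
  decide ((expand p)^[n] x < p)

/-- The product over the countable index set `I` of Bernoulli(`p`) measures on
`Bool` (`P(true) = p`), realized as the joint distribution of the digits of the
Bernoulli(`p`) expansion of a uniform random point of `[0,1)`. -/
noncomputable def bernoulliProduct (I : Type*) [Encodable I] (p : ℝ) :
    Measure (I → Bool) :=
  Measure.map (fun x i => bernDigit p (Encodable.encode i) x)
    (volume.restrict (Set.Ico (0 : ℝ) 1))

/-- Edges of `ℤ²`: `(v, false)` is the horizontal edge from `v` to `v + (1,0)`,
`(v, true)` the vertical edge from `v` to `v + (0,1)`. -/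
abbrev Edge : Type := (ℤ × ℤ) × Bool

/-- An orientation configuration of the edges of `ℤ²`. -/
abbrev Config : Type := Edge → Bool

def eSrc (e : Edge) : ℤ × ℤ := e.1

def eDst (e : Edge) : ℤ × ℤ := if e.2 then (e.1.1, e.1.2 + 1) else (e.1.1 + 1, e.1.2)

/-- The law of the random orientation with parameter `p`: each edge independently
carries the bit `true` with probability `p`. -/
noncomputable def mu (p : ℝ) : Measure Config := bernoulliProduct Edge p

/-- The directed-edge relation of Grimmett's random-orientation model:
`ω e = true` means the edge `e` is oriented in the positive coordinate direction
(rightwards resp. upwards), `ω e = false` in the negative one. -/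
def gStep (ω : Config) (u v : ℤ × ℤ) : Prop :=
  ∃ e : Edge, (eSrc e = u ∧ eDst e = v ∧ ω e = true) ∨ (eSrc e = v ∧ eDst e = u ∧ ω e = false)

/-- Squared euclidean norm on `ℤ²`. -/
def normSq (v : ℤ × ℤ) : ℤ := v.1 ^ 2 + v.2 ^ 2

/-- The directed-edge relation of the H-model: `ω e = true` means the edge `e` is
oriented away from the origin, i.e. towards its endpoint of larger euclidean norm
(adjacent vertices of `ℤ²` never have equal norms). -/
def hStep (ω : Config) (u v : ℤ × ℤ) : Prop :=
  ∃ e : Edge, ((eSrc e = u ∧ eDst e = v) ∨ (eSrc e = v ∧ eDst e = u)) ∧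
    ω e = decide (normSq u < normSq v)

/-- There is an infinite directed self-avoiding path starting at the origin,
all of whose vertices lie in `S`, for the directed-step relation `R`. -/
def percolates (R : ℤ × ℤ → ℤ × ℤ → Prop) (S : Set (ℤ × ℤ)) : Prop :=
  ∃ γ : ℕ → ℤ × ℤ, γ 0 = (0, 0) ∧ Function.Injective γ ∧
    (∀ n, R (γ n) (γ (n + 1))) ∧ ∀ n, γ n ∈ S

/-- The (closed) North-East quadrant of `ℤ²`. -/
def NEquad : Set (ℤ × ℤ) := {v | 0 ≤ v.1 ∧ 0 ≤ v.2}

/-- `θ_H(p)`: percolation probability of the H-model with parameter `p`. -/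
noncomputable def thetaH (p : ℝ) : ℝ≥0∞ := mu p {ω | percolates (hStep ω) Set.univ}

/-- `θ_NE(p)`: probability of an infinite directed self-avoiding path from the
origin staying in the North-East quadrant, in the random-orientation model. -/
noncomputable def thetaNE (p : ℝ) : ℝ≥0∞ := mu p {ω | percolates (gStep ω) NEquad}

/-- `θ_G(p)`: percolation probability of Grimmett's random-orientation model. -/
noncomputable def thetaG (p : ℝ) : ℝ≥0∞ := mu p {ω | percolates (gStep ω) Set.univ}

/-- A fair coin. -/
noncomputable def fairCoin : Measure Bool :=
  (2⁻¹ : ℝ≥0∞) • (Measure.dirac true + Measure.dirac false)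

lemma fairCoin_singleton (b : Bool) : fairCoin {b} = 2⁻¹ := by
  cases b <;> simp [fairCoin]

instance : IsProbabilityMeasure fairCoin where
  measure_univ := by
    simp [fairCoin, ENNReal.inv_two_add_inv_two]

lemma fairCoin_apply (t : Set Bool) :
    fairCoin t = 2⁻¹ * (t.indicator 1 true + t.indicator 1 false) := by
  simp [fairCoin, mul_add]

/-- The law of independent fair bits indexed by the edges of `ℤ²`. -/
noncomputable def coins : Measure Config := Measure.infinitePi fun _ => fairCoin

instance : IsProbabilityMeasure coins := by unfold coins; infer_instance

lemma measurable_expand (p : ℝ) : Measurable (expand p) := by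
  unfold expand
  exact Measurable.ite measurableSet_Iio (by fun_prop) (by fun_prop)

lemma measurable_bernDigit (p : ℝ) (n : ℕ) : Measurable (bernDigit p n) := by
  refine measurable_to_bool ?_
  have : bernDigit p n ⁻¹' {true} = {x | (expand p)^[n] x < p} := by
    ext x
    simp [bernDigit]
  rw [this]
  exact measurableSet_lt ((measurable_expand p).iterate n) measurable_const

/-- The first binary digit and the remaining binary expansion of a uniform point are independent,
with uniform laws. -/
lemma volume_bernDigit_zero_expand (t : Set Bool) {U : Set ℝ} (hU : MeasurableSet U) :
    volume.restrict (Set.Ico (0 : ℝ) 1) {x | bernDigit (1 / 2) 0 x ∈ t ∧ expand (1 / 2) x ∈ U} =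
      fairCoin t * volume.restrict (Set.Ico (0 : ℝ) 1) U := by
  have hm : MeasurableSet {x | bernDigit (1 / 2) 0 x ∈ t ∧ expand (1 / 2) x ∈ U} :=
    (measurable_bernDigit _ 0 (MeasurableSet.of_discrete (s := t))).inter (measurable_expand _ hU)
  set V := U ∩ Set.Ico (0 : ℝ) 1 with hV
  have hVm : MeasurableSet V := hU.inter measurableSet_Ico
  have key1 : volume ((fun x : ℝ => 2 * x) ⁻¹' V) = 2⁻¹ * volume V := by
    rw [Real.volume_preimage_mul_left (by norm_num)]
    congr 1
    rw [abs_of_pos (by norm_num), ENNReal.ofReal_inv_of_pos (by norm_num)]; simp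
  have key2 : volume ((fun x : ℝ => 2 * x + (-1)) ⁻¹' V) = 2⁻¹ * volume V := by
    have : (fun x : ℝ => 2 * x + (-1)) ⁻¹' V =
        (fun x : ℝ => 2 * x) ⁻¹' ((fun x => x + (-1)) ⁻¹' V) :=
      rfl
    rw [this, Real.volume_preimage_mul_left (by norm_num), measure_preimage_add_right]
    congr 1
    rw [abs_of_pos (by norm_num), ENNReal.ofReal_inv_of_pos (by norm_num)]; simp
  have split : {x | bernDigit (1 / 2) 0 x ∈ t ∧ expand (1 / 2) x ∈ U} ∩ Set.Ico (0 : ℝ) 1 =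
      {x | true ∈ t ∧ 2 * x ∈ V} ∪ {x | false ∈ t ∧ 2 * x + (-1) ∈ V} := by
    ext x
    simp only [bernDigit, Function.iterate_zero, id, expand, Set.mem_inter_iff, Set.mem_ofPred_eq,
      Set.mem_union, hV, Set.mem_Ico]
    by_cases hx : x < 1 / 2
    · have e1 : x / (1 / 2) = 2 * x := by ring
      simp only [hx, decide_true, if_true, e1]
      constructor
      · rintro ⟨⟨h1, h2⟩, h3, h4⟩
        exact Or.inl ⟨h1, h2, by linarith, by linarith⟩
      · rintro (⟨h1, h2, h3, h4⟩ | ⟨h1, h2, h3, h4⟩)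
        · exact ⟨⟨h1, h2⟩, by linarith, by linarith⟩
        · linarith
    · have e1 : (x - 1 / 2) / (1 - 1 / 2) = 2 * x + (-1) := by ring
      simp only [hx, decide_false, if_false, e1]
      constructor
      · rintro ⟨⟨h1, h2⟩, h3, h4⟩
        exact Or.inr ⟨h1, h2, by linarith, by linarith⟩
      · rintro (⟨h1, h2, h3, h4⟩ | ⟨h1, h2, h3, h4⟩)
        · linarith
        · exact ⟨⟨h1, h2⟩, by linarith, by linarith⟩
  rw [Measure.restrict_apply hm, Measure.restrict_apply hU, split, ← hV, measure_union,
    fairCoin_apply]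
  · by_cases h1 : true ∈ t <;> by_cases h2 : false ∈ t <;>
      simp only [h1, h2, true_and, false_and, Set.ofPred_false, measure_empty, Set.indicator_of_mem,
        Set.indicator_of_notMem, not_false_eq_true, Pi.one_apply, add_zero, zero_add, mul_one,
        mul_zero, zero_mul]
    · change volume ((fun x : ℝ => 2 * x) ⁻¹' V) + volume ((fun x : ℝ => 2 * x + (-1)) ⁻¹' V) = _
      rw [key1, key2]; ring
    · exact key1
    · exact key2
  · rw [Set.disjoint_left]
    rintro x ⟨-, -, h1⟩ ⟨-, -, h2⟩
    simp only [Set.mem_Ico] at h1 h2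
    linarith
  · exact (MeasurableSet.const (false ∈ t)).inter
      (((measurable_const_mul (2 : ℝ)).add_const (-1)) hVm)

lemma volume_bernDigit_range (n : ℕ) (t : ℕ → Set Bool) :
    volume.restrict (Set.Ico (0 : ℝ) 1) {x | ∀ i < n, bernDigit (1 / 2) i x ∈ t i} =
      ∏ i ∈ Finset.range n, fairCoin (t i) := by
  induction n generalizing t with
  | zero => simp
  | succ n ih =>
    have hm : MeasurableSet {x | ∀ i < n, bernDigit (1 / 2) i x ∈ t (i + 1)} := by
      simp only [Set.ofPred_forall]
      exact MeasurableSet.iInter fun i => MeasurableSet.iInter fun _ =>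
        measurable_bernDigit _ i MeasurableSet.of_discrete
    rw [Finset.prod_range_succ', ← ih fun i => t (i + 1), mul_comm,
      ← volume_bernDigit_zero_expand _ hm]
    congr 1
    ext x
    simp only [Set.mem_ofPred_eq]
    constructor
    · intro h
      exact ⟨h 0 n.succ_pos, fun i hi => h (i + 1) (by omega)⟩
    · rintro ⟨h0, h⟩ (_ | i) hi
      · exact h0
      · exact h i (by omega)

lemma mu_half : mu (1 / 2) = coins := by
  classical
  refine Measure.eq_infinitePi _ fun s t _ => ?_
  have hmeas : Measurable fun (x : ℝ) (i : Edge) => bernDigit (1 / 2) (Encodable.encode i) x :=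
    measurable_pi_lambda _ fun i => measurable_bernDigit _ _
  rw [mu, bernoulliProduct, Measure.map_apply hmeas
    (MeasurableSet.pi s.countable_toSet fun _ _ => MeasurableSet.of_discrete)]
  obtain ⟨n, hn⟩ : ∃ n, ∀ e ∈ s, Encodable.encode e < n :=
    ⟨s.sup Encodable.encode + 1, fun e he =>
      Nat.lt_succ_of_le (Finset.le_sup (f := Encodable.encode) he)⟩
  let t' : ℕ → Set Bool := fun k => {b | ∀ e ∈ s, Encodable.encode e = k → b ∈ t e}
  have ht' : ∀ e ∈ s, t' (Encodable.encode e) = t e := by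
    intro e he
    ext b
    exact ⟨fun h => h e he rfl, fun h e' _ hee => Encodable.encode_injective hee ▸ h⟩
  have h := volume_bernDigit_range n t'
  rw [← Finset.prod_subset (s₁ := s.image Encodable.encode) (by
      intro k hk
      obtain ⟨e, he, rfl⟩ := Finset.mem_image.1 hk
      exact Finset.mem_range.2 (hn e he)) (by
      intro k _ hk
      have : t' k = Set.univ := by
        ext b
        simp only [t', Set.mem_ofPred_eq, Set.mem_univ, iff_true]
        rintro e he rfl
        exact absurd (Finset.mem_image_of_mem _ he) hk
      rw [this, measure_univ]),
    Finset.prod_image fun a _ b _ hab => Encodable.encode_injective hab,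
    Finset.prod_congr rfl fun e he => by rw [ht' e he]] at h
  rw [← h]
  congr 1
  ext x
  simp only [Set.mem_preimage, Set.mem_pi, Finset.mem_coe, Set.mem_ofPred_eq, t']
  constructor
  · rintro hx i _ e he rfl
    exact hx e he
  · intro hx e he
    exact hx _ (hn e he) e he rfl

/-- The event `E` is determined by the bits of the edges in `F`. -/
def DetBy (E : Set Config) (F : Set Edge) : Prop :=
  ∀ ω ω' : Config, (∀ e ∈ F, ω e = ω' e) → ω ∈ E → ω' ∈ E

lemma DetBy.mono {E : Set Config} {F G : Set Edge} (h : DetBy E F) (hFG : F ⊆ G) : DetBy E G :=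
  fun ω ω' hω => h ω ω' fun e he => hω e (hFG he)

lemma DetBy.compl {E : Set Config} {F : Set Edge} (h : DetBy E F) : DetBy Eᶜ F :=
  fun ω ω' hω h1 h2 => h1 (h ω' ω (fun e he => (hω e he).symm) h2)

lemma DetBy.inter {E E' : Set Config} {F : Set Edge} (h : DetBy E F) (h' : DetBy E' F) :
    DetBy (E ∩ E') F :=
  fun ω ω' hω h1 => ⟨h ω ω' hω h1.1, h' ω ω' hω h1.2⟩

lemma DetBy.exists_preimage {E : Set Config} {F : Finset Edge} (h : DetBy E F) :
    ∃ S : Set (F → Bool), E = F.restrict ⁻¹' S := by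
  refine ⟨F.restrict '' E, Set.Subset.antisymm (Set.subset_preimage_image _ _) ?_⟩
  rintro ω ⟨ω', h', hω⟩
  exact h ω' ω (fun e he => congrFun hω ⟨e, he⟩) h'

lemma DetBy.measurableSet {E : Set Config} {F : Set Edge} (h : DetBy E F) (hF : F.Finite) :
    MeasurableSet E := by
  lift F to Finset Edge using hF
  obtain ⟨S, rfl⟩ := h.exists_preimage
  exact (Finset.measurable_restrict F) MeasurableSet.of_discrete

lemma coins_real_inter_of_disjoint {E E' : Set Config} {F F' : Set Edge} (h : DetBy E F)
    (h' : DetBy E' F') (hF : F.Finite) (hF' : F'.Finite) (hd : Disjoint F F') :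
    coins.real (E ∩ E') = coins.real E * coins.real E' := by
  lift F to Finset Edge using hF
  lift F' to Finset Edge using hF'
  rw [Finset.disjoint_coe] at hd
  have hi : ProbabilityTheory.iIndepFun (fun (e : Edge) (ω : Config) => ω e) coins :=
    ProbabilityTheory.iIndepFun_infinitePi (P := fun _ : Edge => fairCoin) (X := fun _ b => b)
      fun _ => measurable_id
  have := hi.indepFun_finset F F' hd fun e => measurable_pi_apply e
  obtain ⟨S, rfl⟩ := h.exists_preimage
  obtain ⟨S', rfl⟩ := h'.exists_preimage
  have := this.measure_inter_preimage_eq_mul S S' MeasurableSet.of_discrete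
    MeasurableSet.of_discrete
  simp only [Measure.real]
  rw [← ENNReal.toReal_mul]
  exact congrArg _ this

/-- The configuration whose open edges are those of `A`. -/
def openSet (A : Finset Edge) : Config := fun e => decide (e ∈ A)

open Classical in
lemma coins_real_eq_card {E : Set Config} {F : Finset Edge} (h : DetBy E F) :
    coins.real E = (F.powerset.filter fun A => openSet A ∈ E).card * (2⁻¹ : ℝ) ^ F.card := by
  have hE : E = ⋃ A ∈ F.powerset.filter fun A => openSet A ∈ E,
      Set.pi (F : Set Edge) fun e => {openSet A e} := by
    ext ω
    simp only [Set.mem_iUnion, Finset.mem_filter, Finset.mem_powerset, Set.mem_pi, Finset.mem_coe,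
      Set.mem_singleton_iff, exists_prop]
    constructor
    · intro hω
      have hA : ∀ e ∈ F, ω e = openSet (F.filter fun e => ω e = true) e := by
        intro e he
        simp [openSet, he]
      exact ⟨F.filter fun e => ω e = true, ⟨Finset.filter_subset _ _, h ω _ hA hω⟩, hA⟩
    · rintro ⟨A, ⟨-, hA⟩, hω⟩
      exact h _ ω (fun e he => (hω e he).symm) hA
  have hcyl : ∀ A : Finset Edge, coins.real (Set.pi (F : Set Edge) fun e => {openSet A e}) =
      (2⁻¹ : ℝ) ^ F.card := by
    intro A
    rw [Measure.real, coins, Measure.infinitePi_pi _ fun _ _ => MeasurableSet.of_discrete]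
    simp [fairCoin_singleton]
  conv_lhs => rw [hE]
  rw [measureReal_biUnion_finset]
  · simp [hcyl]
  · intro A hA B hB hAB
    rw [Function.onFun, Set.disjoint_left]
    intro ω h1 h2
    apply hAB
    simp only [Finset.coe_filter, Finset.mem_powerset, Set.mem_ofPred_eq] at hA hB
    ext e
    by_cases he : e ∈ F
    · have e1 : ω e = openSet A e := h1 e he
      have e2 : ω e = openSet B e := h2 e he
      simpa [openSet] using e1.symm.trans e2
    · exact ⟨fun h => absurd (hA.1 h) he, fun h => absurd (hB.1 h) he⟩
  · intro A _
    exact MeasurableSet.pi F.countable_toSet fun _ _ => MeasurableSet.of_discrete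

/-- The Harris inequality: decreasing events are positively correlated. -/
lemma coins_real_mul_le_inter {E E' : Set Config} {G G' : Set Edge} (h : DetBy E G)
    (h' : DetBy E' G') (hG : G.Finite) (hG' : G'.Finite) (hl : IsLowerSet E)
    (hl' : IsLowerSet E') :
    coins.real E * coins.real E' ≤ coins.real (E ∩ E') := by
  classical
  replace h := h.mono (Set.subset_union_left (t := G'))
  replace h' := h'.mono (Set.subset_union_right (s := G))
  obtain ⟨F, hF⟩ := (hG.union hG').exists_finset_coe
  rw [← hF] at h h'
  rw [coins_real_eq_card h, coins_real_eq_card h', coins_real_eq_card (h.inter h')]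
  have key : ∀ {E : Set Config}, IsLowerSet E →
      IsLowerSet ((F.powerset.filter fun A => openSet A ∈ E : Finset (Finset Edge)) :
        Set (Finset Edge)) := by
    intro E hE A B hBA hA
    simp only [Finset.coe_filter, Finset.mem_powerset, Set.mem_ofPred_eq] at hA ⊢
    refine ⟨hBA.trans hA.1, hE (fun e => ?_) hA.2⟩
    by_cases he : e ∈ B
    · simp [openSet, he, hBA he]
    · simp [openSet, he]
  have := (key hl).le_card_inter_finset' (key hl') (s := F)
    (fun t ht => Finset.mem_powerset.1 (Finset.mem_filter.1 ht).1)
    (fun t ht => Finset.mem_powerset.1 (Finset.mem_filter.1 ht).1)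
  rw [← Finset.filter_and] at this
  have this' : ((F.powerset.filter fun A => openSet A ∈ E).card : ℝ) *
      (F.powerset.filter fun A => openSet A ∈ E').card ≤
      2 ^ F.card * (F.powerset.filter fun A => openSet A ∈ E ∩ E').card := by
    exact_mod_cast this
  have hp : (0 : ℝ) < 2⁻¹ ^ F.card := by positivity
  have h2 : (2 : ℝ) ^ F.card * 2⁻¹ ^ F.card = 1 := by
    rw [← mul_pow]; norm_num
  calc _ = ((F.powerset.filter fun A => openSet A ∈ E).card : ℝ) *
      (F.powerset.filter fun A => openSet A ∈ E').card * (2⁻¹ ^ F.card * 2⁻¹ ^ F.card) := by ring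
    _ ≤ 2 ^ F.card * (F.powerset.filter fun A => openSet A ∈ E ∩ E').card *
        (2⁻¹ ^ F.card * 2⁻¹ ^ F.card) := by gcongr
    _ = (2 ^ F.card * 2⁻¹ ^ F.card) *
        ((F.powerset.filter fun A => openSet A ∈ E ∩ E').card * 2⁻¹ ^ F.card) := by ring
    _ = _ := by rw [h2, one_mul]; congr!

lemma measurePreserving_comp {σ : Edge → Edge} (hσ : Function.Injective σ) :
    MeasurePreserving (fun ω : Config => ω ∘ σ) coins coins :=
  ⟨by fun_prop, Measure.map_infinitePi_infinitePi_of_inj (P := fun _ => fairCoin) hσ⟩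

lemma map_not_fairCoin : fairCoin.map not = fairCoin := by
  refine Measure.ext_of_singleton fun b => ?_
  rw [Measure.map_apply measurable_from_top MeasurableSet.of_discrete]
  have : not ⁻¹' {b} = {!b} := by ext c; cases b <;> cases c <;> simp
  rw [this, fairCoin_singleton, fairCoin_singleton]

open Classical in
/-- Flip the bits of the edges in `s`. -/
noncomputable def flipOn (s : Set Edge) (ω : Config) : Config :=
  fun e => if e ∈ s then !ω e else ω e

lemma measurePreserving_flipOn (s : Set Edge) : MeasurePreserving (flipOn s) coins coins := by
  classical
  have hm : ∀ e, Measurable (fun b : Bool => if e ∈ s then !b else b) :=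
    fun e => measurable_from_top
  refine ⟨measurable_pi_lambda _ fun e => (hm e).comp (measurable_pi_apply e), ?_⟩
  have := Measure.infinitePi_map_pi (fun _ : Edge => fairCoin)
    (f := fun e b => if e ∈ s then !b else b) hm
  refine this.trans ?_
  unfold coins
  congr 1
  funext e
  by_cases he : e ∈ s
  · simp only [he, if_true]; exact map_not_fairCoin
  · simp [he]

/-- The edge `e` has endpoints `u` and `v`. -/
def Joins (e : Edge) (u v : ℤ × ℤ) : Prop :=
  (eSrc e = u ∧ eDst e = v) ∨ (eSrc e = v ∧ eDst e = u)

/-- `u` and `v` are the endpoints of an open edge of the bond configuration `ω`. -/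
def Adj (ω : Config) (u v : ℤ × ℤ) : Prop := ∃ e, Joins e u v ∧ ω e = true

/-- Nearest neighbours in `ℤ²`. -/
def Nbr (u v : ℤ × ℤ) : Prop :=
  (u.1 = v.1 ∧ (v.2 = u.2 + 1 ∨ u.2 = v.2 + 1)) ∨ (u.2 = v.2 ∧ (v.1 = u.1 + 1 ∨ u.1 = v.1 + 1))

lemma Joins.symm {e : Edge} {u v : ℤ × ℤ} (h : Joins e u v) : Joins e v u := Or.symm h

lemma Joins.nbr {e : Edge} {u v : ℤ × ℤ} (h : Joins e u v) : Nbr u v := by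
  obtain ⟨⟨x, y⟩, b⟩ := e
  obtain ⟨rfl, rfl⟩ | ⟨rfl, rfl⟩ := h <;> cases b <;> simp [Nbr, eSrc, eDst]

lemma Nbr.symm {u v : ℤ × ℤ} (h : Nbr u v) : Nbr v u := by
  unfold Nbr at *
  omega

lemma Adj.symm {ω : Config} {u v : ℤ × ℤ} : Adj ω u v → Adj ω v u :=
  fun ⟨e, h, he⟩ => ⟨e, h.symm, he⟩

lemma Adj.nbr {ω : Config} {u v : ℤ × ℤ} : Adj ω u v → Nbr u v := fun ⟨_, h, _⟩ => h.nbr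

lemma Adj.mono {ω ω' : Config} (h : ω ≤ ω') {u v : ℤ × ℤ} : Adj ω u v → Adj ω' u v :=
  fun ⟨e, he, ho⟩ => ⟨e, he, h e ho⟩

/-- Reachability by nearest-neighbour paths staying in `A`. -/
def Path (A : Set (ℤ × ℤ)) : ℤ × ℤ → ℤ × ℤ → Prop :=
  Relation.ReflTransGen fun u v => Nbr u v ∧ u ∈ A ∧ v ∈ A

/-- Reachability by open paths staying in `A`. -/
def Conn (ω : Config) (A : Set (ℤ × ℤ)) : ℤ × ℤ → ℤ × ℤ → Prop :=
  Relation.ReflTransGen fun u v => Adj ω u v ∧ u ∈ A ∧ v ∈ A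

section
variable {ω ω' : Config} {A B P Q P' Q' : Set (ℤ × ℤ)} {u v w : ℤ × ℤ}

lemma Conn.path (h : Conn ω A u v) : Path A u v :=
  Relation.ReflTransGen.mono (fun _ _ h => ⟨h.1.nbr, h.2⟩) _ _ h

lemma Path.mono (h : Path A u v) (hAB : A ⊆ B) : Path B u v :=
  Relation.ReflTransGen.mono (fun _ _ h => ⟨h.1, hAB h.2.1, hAB h.2.2⟩) _ _ h

lemma Path.symm (h : Path A u v) : Path A v u := by
  induction h with
  | refl => exact .refl
  | tail _ h ih => exact ih.head ⟨h.1.symm, h.2.2, h.2.1⟩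

lemma Conn.symm (h : Conn ω A u v) : Conn ω A v u := by
  induction h with
  | refl => exact .refl
  | tail _ h ih => exact ih.head ⟨h.1.symm, h.2.2, h.2.1⟩

lemma Conn.mono (h : Conn ω A u v) (hω : ω ≤ ω') (hAB : A ⊆ B) : Conn ω' B u v :=
  Relation.ReflTransGen.mono (fun _ _ h => ⟨h.1.mono hω, hAB h.2.1, hAB h.2.2⟩) _ _ h

lemma Conn.trans (h : Conn ω A u v) (h' : Conn ω A v w) : Conn ω A u w :=
  Relation.ReflTransGen.trans h h'

lemma Path.mem (h : Path A u v) (hu : u ∈ A) : v ∈ A := by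
  obtain rfl | ⟨_, _, h⟩ := Relation.ReflTransGen.cases_tail h
  · exact hu
  · exact h.2.2

lemma Conn.mem (h : Conn ω A u v) (hu : u ∈ A) : v ∈ A := h.path.mem hu

lemma Conn.of_forall_mem (h : Conn ω A u v) (hB : ∀ w, Conn ω A u w → w ∈ B) :
    Conn ω B u v := by
  induction h with
  | refl => exact .refl
  | tail h1 h2 ih => exact ih.tail ⟨h2.1, hB _ h1, hB _ (h1.tail h2)⟩

/-- Some open path inside `A` connects `P` to `Q`. -/
def Cross (ω : Config) (A P Q : Set (ℤ × ℤ)) : Prop :=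
  ∃ u ∈ A, u ∈ P ∧ ∃ v ∈ Q, Conn ω A u v

lemma Cross.symm (h : Cross ω A P Q) : Cross ω A Q P := by
  obtain ⟨u, hu, hP, v, hQ, h⟩ := h
  exact ⟨v, h.mem hu, hQ, u, hP, h.symm⟩

lemma Cross.mono (h : Cross ω A P Q) (hω : ω ≤ ω') (hA : A ⊆ B) (hP : A ∩ P ⊆ P')
    (hQ : A ∩ Q ⊆ Q') : Cross ω' B P' Q' := by
  obtain ⟨u, hu, huP, v, hv, h⟩ := h
  exact ⟨u, hA hu, hP ⟨hu, huP⟩, v, hQ ⟨h.mem hu, hv⟩, h.mono hω hA⟩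

/-- A path from `{f ≤ l}` to `{m ≤ f}` crosses the strip `{l ≤ f ≤ m}`. -/
lemma Conn.cross_strip (f : ℤ × ℤ → ℤ) (hf : ∀ u v, Nbr u v → f v ≤ f u + 1) {l m : ℤ}
    (hlm : l ≤ m) (h : Conn ω A u v) (huA : u ∈ A) (hu : f u ≤ l) (hv : m ≤ f v) :
    Cross ω {w | w ∈ A ∧ l ≤ f w ∧ f w ≤ m} {w | f w = l} {w | f w = m} := by
  by_contra hc
  have key : f v < l ∨ (f v < m ∧ ∃ w, f w = l ∧ (w ∈ A ∧ l ≤ f w ∧ f w ≤ m) ∧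
      l ≤ f v ∧ Conn ω {w | w ∈ A ∧ l ≤ f w ∧ f w ≤ m} w v) := by
    clear hv
    have main : ∀ v, (∃ w, f w = l ∧ (w ∈ A ∧ l ≤ f w ∧ f w ≤ m) ∧ l ≤ f v ∧ f v ≤ m ∧
        Conn ω {w | w ∈ A ∧ l ≤ f w ∧ f w ≤ m} w v) → (f v < m ∧ ∃ w, f w = l ∧
        (w ∈ A ∧ l ≤ f w ∧ f w ≤ m) ∧ l ≤ f v ∧
        Conn ω {w | w ∈ A ∧ l ≤ f w ∧ f w ≤ m} w v) := by
      rintro v ⟨w, h1, h2, h3, h4, h5⟩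
      refine ⟨lt_of_le_of_ne h4 fun h => hc ⟨w, h2, h1, v, h, h5⟩, w, h1, h2, h3, h5⟩
    induction h with
    | refl =>
      rcases lt_or_eq_of_le hu with h | h
      · exact Or.inl h
      · exact Or.inr (main _ ⟨u, h, ⟨huA, h.ge, by omega⟩, h.ge, by omega, .refl⟩)
    | @tail x y h1 h2 ih =>
      have hxy := hf x y h2.1.nbr
      rcases lt_or_ge (f y) l with hy | hy
      · exact Or.inl hy
      · rcases ih with ih | ⟨hx, w, h3, h4, h5, h6⟩
        · exact Or.inr (main _ ⟨y, by omega, ⟨h2.2.2, hy, by omega⟩, hy, by omega, .refl⟩)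
        · exact Or.inr (main _ ⟨w, h3, h4, hy, by omega,
            h6.tail ⟨h2.1, ⟨h2.2.1, h5, hx.le⟩, h2.2.2, hy, by omega⟩⟩)
  omega

end

/-- The edges with both endpoints in `A`. -/
def edgesIn (A : Set (ℤ × ℤ)) : Set Edge := {e | eSrc e ∈ A ∧ eDst e ∈ A}

lemma edgesIn_mono {A B : Set (ℤ × ℤ)} (h : A ⊆ B) : edgesIn A ⊆ edgesIn B :=
  fun _ he => ⟨h he.1, h he.2⟩

lemma finite_edgesIn {A : Set (ℤ × ℤ)} (h : A.Finite) : (edgesIn A).Finite :=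
  (h.prod (Set.finite_univ (α := Bool))).subset fun _ he => ⟨he.1, trivial⟩

lemma Joins.mem_edgesIn {e : Edge} {u v : ℤ × ℤ} {A : Set (ℤ × ℤ)} (h : Joins e u v) (hu : u ∈ A)
    (hv : v ∈ A) : e ∈ edgesIn A := by
  obtain ⟨rfl, rfl⟩ | ⟨rfl, rfl⟩ := h
  exacts [⟨hu, hv⟩, ⟨hv, hu⟩]

/-- The event that no open path inside `A` connects `P` to `Q`. -/
def NoCross (A P Q : Set (ℤ × ℤ)) : Set Config := {ω | ¬ Cross ω A P Q}

lemma isLowerSet_noCross (A P Q : Set (ℤ × ℤ)) : IsLowerSet (NoCross A P Q) :=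
  fun _ _ hle h hc => h (hc.mono hle subset_rfl Set.inter_subset_right Set.inter_subset_right)

lemma Conn.congr {ω ω' : Config} {A : Set (ℤ × ℤ)} (hω : ∀ e ∈ edgesIn A, ω e = ω' e) {u v : ℤ × ℤ}
    (h : Conn ω A u v) : Conn ω' A u v :=
  Relation.ReflTransGen.mono (fun _ _ ⟨⟨e, he, ho⟩, hu, hv⟩ =>
    ⟨⟨e, he, (hω e (he.mem_edgesIn hu hv)).symm.trans ho⟩, hu, hv⟩) _ _ h

lemma detBy_noCross (A P Q : Set (ℤ × ℤ)) : DetBy (NoCross A P Q) (edgesIn A) := by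
  rintro ω ω' hω h ⟨u, hu, huP, v, hv, hc⟩
  exact h ⟨u, hu, huP, v, hv, hc.congr fun e he => (hω e he).symm⟩

/-- The edge map `σ` is induced by the vertex map `f`. -/
def Induces (f : ℤ × ℤ → ℤ × ℤ) (σ : Edge → Edge) : Prop :=
  ∀ e u v, Joins e u v → Joins (σ e) (f u) (f v)

lemma Conn.map {f : ℤ × ℤ → ℤ × ℤ} {σ : Edge → Edge} (hσ : Induces f σ) {ω : Config}
    {A A' : Set (ℤ × ℤ)} (hA : ∀ v ∈ A, f v ∈ A') {u v : ℤ × ℤ} (h : Conn (ω ∘ σ) A u v) :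
    Conn ω A' (f u) (f v) := by
  induction h with
  | refl => exact .refl
  | tail h1 h2 ih =>
    obtain ⟨⟨e, he, ho⟩, ha, hb⟩ := h2
    exact ih.tail ⟨⟨σ e, hσ _ _ _ he, ho⟩, hA _ ha, hA _ hb⟩

lemma Cross.map {f : ℤ × ℤ → ℤ × ℤ} {σ : Edge → Edge} (hσ : Induces f σ)
    {ω : Config} {A P Q A' P' Q' : Set (ℤ × ℤ)} (hA : ∀ v ∈ A, f v ∈ A')
    (hP : ∀ v ∈ A, v ∈ P → f v ∈ P') (hQ : ∀ v ∈ A, v ∈ Q → f v ∈ Q')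
    (h : Cross (ω ∘ σ) A P Q) : Cross ω A' P' Q' := by
  obtain ⟨u, hu, huP, v, hv, hc⟩ := h
  exact ⟨f u, hA u hu, hP u hu huP, f v, hQ v (hc.mem hu) hv, hc.map hσ hA⟩

lemma coins_noCross_le_of_map {f : ℤ × ℤ → ℤ × ℤ} {σ : Edge → Edge} (hσ : Induces f σ)
    (hinj : Function.Injective σ)
    {A P Q A' P' Q' : Set (ℤ × ℤ)} (hfin : A.Finite) (hA : ∀ v ∈ A, f v ∈ A')
    (hP : ∀ v ∈ A, v ∈ P → f v ∈ P') (hQ : ∀ v ∈ A, v ∈ Q → f v ∈ Q') :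
    coins.real (NoCross A' P' Q') ≤ coins.real (NoCross A P Q) := by
  have hsub : NoCross A' P' Q' ⊆ (fun ω : Config => ω ∘ σ) ⁻¹' NoCross A P Q :=
    fun ω h hc => h (hc.map hσ hA hP hQ)
  refine (measureReal_mono hsub).trans_eq ?_
  exact (measurePreserving_comp hinj).measureReal_preimage
    ((detBy_noCross A P Q).measurableSet (finite_edgesIn hfin)).nullMeasurableSet

/-- Translation of edges by `(a, b)`. -/
def translateEdge (a b : ℤ) (e : Edge) : Edge := ((e.1.1 + a, e.1.2 + b), e.2)

/-- Reflection of edges in the line `x = c / 2`. -/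
def reflectXEdge (c : ℤ) (e : Edge) : Edge := ((c - e.1.1 - if e.2 then 0 else 1, e.1.2), e.2)

/-- Reflection of edges in the line `y = c / 2`. -/
def reflectYEdge (c : ℤ) (e : Edge) : Edge := ((e.1.1, c - e.1.2 - if e.2 then 1 else 0), e.2)

/-- Reflection of edges in the diagonal. -/
def transposeEdge (e : Edge) : Edge := ((e.1.2, e.1.1), !e.2)

lemma induces_of_endpoints {f : ℤ × ℤ → ℤ × ℤ} {σ : Edge → Edge}
    (h : ∀ e, Joins (σ e) (f (eSrc e)) (f (eDst e))) : Induces f σ := by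
  rintro e u v (⟨rfl, rfl⟩ | ⟨rfl, rfl⟩)
  exacts [h e, (h e).symm]

lemma induces_translateEdge (a b : ℤ) :
    Induces (fun v => (v.1 + a, v.2 + b)) (translateEdge a b) := by
  refine induces_of_endpoints ?_
  rintro ⟨⟨x, y⟩, _ | _⟩ <;>
    simp [Joins, translateEdge, eSrc, eDst] <;> omega

lemma induces_reflectXEdge (c : ℤ) : Induces (fun v => (c - v.1, v.2)) (reflectXEdge c) := by
  refine induces_of_endpoints ?_
  rintro ⟨⟨x, y⟩, _ | _⟩
  · simp [Joins, reflectXEdge, eSrc, eDst]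
    omega
  · simp [Joins, reflectXEdge, eSrc, eDst]

lemma induces_reflectYEdge (c : ℤ) : Induces (fun v => (v.1, c - v.2)) (reflectYEdge c) := by
  refine induces_of_endpoints ?_
  rintro ⟨⟨x, y⟩, _ | _⟩
  · simp [Joins, reflectYEdge, eSrc, eDst]
  · simp [Joins, reflectYEdge, eSrc, eDst]
    omega

lemma induces_transposeEdge : Induces (fun v => (v.2, v.1)) transposeEdge := by
  refine induces_of_endpoints ?_
  rintro ⟨⟨x, y⟩, _ | _⟩ <;> simp [Joins, transposeEdge, eSrc, eDst]

lemma injective_translateEdge (a b : ℤ) : Function.Injective (translateEdge a b) := by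
  rintro ⟨⟨x, y⟩, s⟩ ⟨⟨x', y'⟩, s'⟩ h
  simpa [translateEdge] using h

lemma involutive_reflectXEdge (c : ℤ) : Function.Involutive (reflectXEdge c) := by
  rintro ⟨⟨x, y⟩, _ | _⟩ <;> simp [reflectXEdge, sub_sub]

lemma involutive_reflectYEdge (c : ℤ) : Function.Involutive (reflectYEdge c) := by
  rintro ⟨⟨x, y⟩, _ | _⟩ <;> simp [reflectYEdge, sub_sub]

lemma involutive_transposeEdge : Function.Involutive transposeEdge := by
  rintro ⟨⟨x, y⟩, s⟩
  simp [transposeEdge]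

/-- The rectangle `[a, b] × [c, d]`. -/
def Rect (a b c d : ℤ) : Set (ℤ × ℤ) := {v | a ≤ v.1 ∧ v.1 ≤ b ∧ c ≤ v.2 ∧ v.2 ≤ d}

lemma finite_rect (a b c d : ℤ) : (Rect a b c d).Finite :=
  ((Set.finite_Icc a b).prod (Set.finite_Icc c d)).subset fun _ h =>
    ⟨⟨h.1, h.2.1⟩, h.2.2.1, h.2.2.2⟩

/-- No open path crosses the rectangle `[a, b] × [c, d]` from bottom to top. -/
def NoV (a b c d : ℤ) : Set Config := NoCross (Rect a b c d) {v | v.2 = c} {v | v.2 = d}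

/-- No open path crosses the rectangle `[a, b] × [c, d]` from left to right. -/
def NoH (a b c d : ℤ) : Set Config := NoCross (Rect a b c d) {v | v.1 = a} {v | v.1 = b}

lemma coins_NoV_translate (a b c d s t : ℤ) :
    coins.real (NoV a b c d) ≤ coins.real (NoV (a + s) (b + s) (c + t) (d + t)) := by
  refine coins_noCross_le_of_map (induces_translateEdge (-s) (-t)) (injective_translateEdge _ _)
    (finite_rect _ _ _ _) ?_ ?_ ?_
  · rintro v ⟨h1, h2, h3, h4⟩
    exact ⟨by dsimp only; omega, by dsimp only; omega, by dsimp only; omega, by dsimp only; omega⟩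
  · rintro v - (h : _ = _)
    show _ = _
    omega
  · rintro v - (h : _ = _)
    show _ = _
    omega

lemma coins_NoV_le_NoH (a b c d : ℤ) : coins.real (NoV a b c d) ≤ coins.real (NoH c d a b) :=
  coins_noCross_le_of_map induces_transposeEdge involutive_transposeEdge.injective
    (finite_rect _ _ _ _) (fun _ ⟨h1, h2, h3, h4⟩ => ⟨h3, h4, h1, h2⟩) (fun _ _ h => h)
    fun _ _ h => h

lemma coins_NoH_le_NoV (a b c d : ℤ) : coins.real (NoH a b c d) ≤ coins.real (NoV c d a b) :=
  coins_noCross_le_of_map induces_transposeEdge involutive_transposeEdge.injective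
    (finite_rect _ _ _ _) (fun _ ⟨h1, h2, h3, h4⟩ => ⟨h3, h4, h1, h2⟩) (fun _ _ h => h)
    fun _ _ h => h

lemma coins_NoH_translate (a b c d s t : ℤ) :
    coins.real (NoH a b c d) ≤ coins.real (NoH (a + s) (b + s) (c + t) (d + t)) :=
  (coins_NoH_le_NoV _ _ _ _).trans ((coins_NoV_translate _ _ _ _ t s).trans
    (coins_NoV_le_NoH _ _ _ _))

/-- Non-crossing events of overlapping rectangles can be glued. -/
lemma NoV_glue {a a' b' b c d : ℤ} (hab : a' ≤ b') :
    NoV a b' c d ∩ NoV a' b c d ∩ NoH a' b' c d ⊆ NoV a b c d := by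
  rintro ω ⟨⟨h1, h2⟩, h3⟩ ⟨u, hu, hub, v, hv, h⟩
  by_cases hl : ∃ w, Conn ω (Rect a b c d) u w ∧ w.1 < a'
  · by_cases hr : ∃ w, Conn ω (Rect a b c d) u w ∧ b' < w.1
    · obtain ⟨w, hw, hwl⟩ := hl
      obtain ⟨w', hw', hwr⟩ := hr
      have := (hw.symm.trans hw').cross_strip Prod.fst (l := a') (m := b')
        (fun u v h => by unfold Nbr at h; omega) hab (hw.mem hu) hwl.le hwr.le
      refine h3 (this.mono le_rfl ?_ Set.inter_subset_right Set.inter_subset_right)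
      rintro x ⟨⟨_, _, h3, h4⟩, h5, h6⟩
      exact ⟨h5, h6, h3, h4⟩
    · push Not at hr
      refine h1 ⟨u, ⟨hu.1, hr _ .refl, hu.2.2⟩, hub, v, hv, h.of_forall_mem fun w hw => ?_⟩
      exact ⟨(hw.mem hu).1, hr _ hw, (hw.mem hu).2.2⟩
  · push Not at hl
    refine h2 ⟨u, ⟨hl _ .refl, hu.2⟩, hub, v, hv, h.of_forall_mem fun w hw => ?_⟩
    exact ⟨hl _ hw, (hw.mem hu).2⟩

/-- Signed count `n v` of the crossings of a path in `B` from `b₀` to `b` with the horizontal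
half-line to the right of `v + (0, 1/2)`: it is locally constant off `B`, up to the endpoints. -/
lemma Path.exists_crossing_number {B : Set (ℤ × ℤ)} {b₀ b : ℤ × ℤ}
    (h : Path B b₀ b) : ∃ n : ℤ → ℤ → ℤ,
      (∀ x y, (x + 1, y) ∉ B → n x y = n (x + 1) y) ∧
      (∀ x y, (x, y + 1) ∉ B → n x y - n x (y + 1) =
        (if b.2 = y + 1 ∧ x < b.1 then 1 else 0) - (if b₀.2 = y + 1 ∧ x < b₀.1 then 1 else 0)) ∧
      (∀ x y, (∀ w ∈ B, x < w.1) → n x y =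
        (if b₀.2 ≤ y then 1 else 0) - (if b.2 ≤ y then 1 else 0)) ∧
      (∀ x y, (∀ w ∈ B, w.1 ≤ x) → n x y = 0) := by
  induction h with
  | refl => exact ⟨fun _ _ => 0, by simp⟩
  | @tail b c _ h2 ih =>
    obtain ⟨n, h3, h4, h5, h6⟩ := ih
    obtain ⟨hbc, hb, hc⟩ := h2
    obtain ⟨b1, b2⟩ := b
    obtain ⟨c1, c2⟩ := c
    simp only [Nbr] at hbc
    refine ⟨fun x y => n x y +
      if x < b1 then (if b2 ≤ y then 1 else 0) - (if c2 ≤ y then 1 else 0) else 0, ?_, ?_, ?_, ?_⟩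
    · intro x y hxy
      have e1 : ¬ (x + 1 = b1 ∧ y = b2) := by rintro ⟨rfl, rfl⟩; exact hxy hb
      have e2 : ¬ (x + 1 = c1 ∧ y = c2) := by rintro ⟨rfl, rfl⟩; exact hxy hc
      have := h3 x y hxy
      dsimp only
      split_ifs <;> omega
    · intro x y hxy
      have e1 : ¬ (x = b1 ∧ y + 1 = b2) := by rintro ⟨rfl, rfl⟩; exact hxy hb
      have e2 : ¬ (x = c1 ∧ y + 1 = c2) := by rintro ⟨rfl, rfl⟩; exact hxy hc
      have := h4 x y hxy
      dsimp only at this ⊢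
      split_ifs at this ⊢ <;> omega
    · intro x y hxy
      have e1 := hxy _ hb
      have := h5 x y hxy
      dsimp only at this e1 ⊢
      split_ifs at this ⊢ <;> omega
    · intro x y hxy
      have e1 := hxy _ hb
      have := h6 x y hxy
      dsimp only at this e1 ⊢
      split_ifs at this ⊢ <;> omega

/-- A horizontal and a vertical crossing of a rectangle meet. -/
lemma Path.inter_nonempty {A B : Set (ℤ × ℤ)} {a a' b b' : ℤ × ℤ} {c d : ℤ} (hA : Path A a a')
    (hB : Path B b b') (ha : a ∈ A) (hAy : ∀ v ∈ A, c ≤ v.2 ∧ v.2 ≤ d)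
    (hax : ∀ w ∈ B, a.1 < w.1) (hax' : ∀ w ∈ B, w.1 ≤ a'.1) (hby : b.2 ≤ c) (hby' : d < b'.2) :
    (A ∩ B).Nonempty := by
  by_contra hne
  have hdisj : ∀ v ∈ A, v ∉ B := fun v h1 h2 => hne ⟨v, h1, h2⟩
  obtain ⟨n, h1, h2, h3, h4⟩ := hB.exists_crossing_number
  have key : n a'.1 a'.2 = 1 := by
    clear hax'
    induction hA with
    | refl =>
      have := hAy a ha
      rw [h3 _ _ hax, if_pos (by omega), if_neg (by omega)]
      rfl
    | @tail u v hu huv ih =>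
      obtain ⟨huv, hu, hv⟩ := huv
      have := hAy u hu
      have := hAy v hv
      have e1 := hdisj u hu
      have e2 := hdisj v hv
      obtain ⟨u1, u2⟩ := u
      obtain ⟨v1, v2⟩ := v
      simp only [Nbr] at huv ih ⊢
      dsimp only at *
      rcases huv with ⟨rfl, rfl | rfl⟩ | ⟨rfl, rfl | rfl⟩
      · have := h2 u1 u2 e2
        rw [if_neg (by omega), if_neg (by omega)] at this
        omega
      · have := h2 u1 v2 e1
        rw [if_neg (by omega), if_neg (by omega)] at this
        omega
      · have := h1 u1 u2 e2
        omega
      · have := h1 v1 u2 e1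
        omega
  rw [h4 _ _ hax'] at key
  exact absurd key (by decide)

/-- The midpoint of an edge, in coordinates scaled by two. -/
def mid (e : Edge) : ℤ × ℤ :=
  (2 * e.1.1 + if e.2 then 0 else 1, 2 * e.1.2 + if e.2 then 1 else 0)

lemma injective_mid : Function.Injective mid := by
  rintro ⟨⟨x, y⟩, _ | _⟩ ⟨⟨x', y'⟩, _ | _⟩ h <;> simp [mid] at h ⊢ <;> omega

/-- The edge crossed by the dual edge that is identified with the given edge by means of the
embedding `(a, b) ↦ (b + 1/2, a - 1/2)` of `ℤ²` onto the dual lattice. -/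
def dualEdge (e : Edge) : Edge :=
  ((e.1.2 + if e.2 then 1 else 0, e.1.1 - if e.2 then 1 else 0), e.2)

lemma involutive_dualEdge : Function.Involutive dualEdge := by
  rintro ⟨⟨x, y⟩, _ | _⟩ <;> simp [dualEdge]

/-- The dual bond configuration. -/
def dual (ω : Config) : Config := fun e => !ω (dualEdge e)

lemma measurePreserving_dual : MeasurePreserving dual coins coins := by
  convert (measurePreserving_flipOn Set.univ).comp
    (measurePreserving_comp involutive_dualEdge.injective) using 1
  ext ω e
  simp [dual, flipOn]

lemma Conn.path_mid {ω : Config} {A : Set (ℤ × ℤ)} {B : Set (ℤ × ℤ)} {u v : ℤ × ℤ}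
    {g : ℤ × ℤ → ℤ × ℤ} {m : Edge → ℤ × ℤ} (hg : ∀ v ∈ A, g v ∈ B)
    (hm : ∀ e ∈ edgesIn A, ω e = true → m e ∈ B)
    (hn : ∀ e, Nbr (g (eSrc e)) (m e) ∧ Nbr (m e) (g (eDst e)))
    (h : Conn ω A u v) : Path B (g u) (g v) := by
  induction h with
  | refl => exact .refl
  | tail h1 h2 ih =>
    obtain ⟨⟨e, he, ho⟩, ha, hb⟩ := h2
    have hmB := hm e (he.mem_edgesIn ha hb) ho
    refine (ih.tail (b := _) (c := m e) ⟨?_, hg _ ha, hmB⟩).tail ⟨?_, hmB, hg _ hb⟩ <;>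
      obtain ⟨rfl, rfl⟩ | ⟨rfl, rfl⟩ := he
    exacts [(hn e).1, (hn e).2.symm, (hn e).2, (hn e).1.symm]

/-- A rectangle and its dual are not both crossed. -/
lemma mem_NoH_or_dual_mem_NoH {n : ℤ} (ω : Config) :
    ω ∈ NoH 0 (n + 1) 0 n ∨ dual ω ∈ NoH 0 (n + 1) 0 n := by
  by_contra! hc
  obtain ⟨h1, h2⟩ := hc
  simp only [NoH, NoCross, Set.mem_ofPred_eq, not_not] at h1 h2
  obtain ⟨a, ha, hal, a', har, hA⟩ := h1
  obtain ⟨b, hb, hbl, b', hbr, hB⟩ := h2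
  have ha' := hA.mem ha
  have hb' := hB.mem hb
  set R := Rect 0 (n + 1) 0 n with hR
  simp only [Set.mem_ofPred_eq] at hal har hbl hbr
  have pA := hA.path_mid (B := {w | (∃ v ∈ R, w = (2 * v.1, 2 * v.2)) ∨
      ∃ e ∈ edgesIn R, ω e = true ∧ w = mid e}) (g := fun v => (2 * v.1, 2 * v.2)) (m := mid)
      (fun v hv => Or.inl ⟨v, hv, rfl⟩) (fun e he ho => Or.inr ⟨e, he, ho, rfl⟩) (by
        rintro ⟨⟨x, y⟩, _ | _⟩ <;> simp [Nbr, mid, eSrc, eDst] <;> omega)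
  have pB := hB.path_mid (B := {w | (∃ v ∈ R, w = (2 * v.2 + 1, 2 * v.1 - 1)) ∨
      ∃ e ∈ edgesIn R, dual ω e = true ∧ w = mid (dualEdge e)})
      (g := fun v => (2 * v.2 + 1, 2 * v.1 - 1)) (m := fun e => mid (dualEdge e))
      (fun v hv => Or.inl ⟨v, hv, rfl⟩) (fun e he ho => Or.inr ⟨e, he, ho, rfl⟩) (by
        rintro ⟨⟨x, y⟩, _ | _⟩ <;> simp [Nbr, mid, eSrc, eDst, dualEdge] <;> omega)
  have hBx : ∀ w ∈ {w : ℤ × ℤ | (∃ v ∈ R, w = (2 * v.2 + 1, 2 * v.1 - 1)) ∨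
      ∃ e ∈ edgesIn R, dual ω e = true ∧ w = mid (dualEdge e)}, 0 < w.1 ∧ w.1 ≤ 2 * n + 2 := by
    rintro w (⟨v, hv, rfl⟩ | ⟨⟨⟨x, y⟩, _ | _⟩, he, -, rfl⟩)
    · obtain ⟨h1, h2, h3, h4⟩ := hv
      dsimp only
      omega
    all_goals
      obtain ⟨⟨h1, h2, h3, h4⟩, h5, h6, h7, h8⟩ := he
      simp [mid, dualEdge, eSrc, eDst] at *
      omega
  obtain ⟨w, hwA, hwB⟩ := pA.inter_nonempty pB (c := 0) (d := 2 * n) (Or.inl ⟨a, ha, rfl⟩) (by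
      rintro w (⟨v, hv, rfl⟩ | ⟨⟨⟨x, y⟩, _ | _⟩, he, -, rfl⟩)
      · obtain ⟨h1, h2, h3, h4⟩ := hv
        dsimp only
        omega
      all_goals
        obtain ⟨⟨h1, h2, h3, h4⟩, h5, h6, h7, h8⟩ := he
        simp [mid, eSrc, eDst] at *
        omega) (fun w hw => by have := hBx w hw; dsimp only; omega)
      (fun w hw => by have := hBx w hw; dsimp only; omega)
      (by dsimp only; omega) (by dsimp only; omega)
  rcases hwA with ⟨v, -, rfl⟩ | ⟨e, -, ho, rfl⟩
  · rcases hwB with ⟨v', -, h⟩ | ⟨⟨⟨x, y⟩, _ | _⟩, -, -, h⟩ <;>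
      simp [mid, dualEdge] at h <;> omega
  · rcases hwB with ⟨v', -, h⟩ | ⟨e', -, ho', h⟩
    · obtain ⟨⟨x, y⟩, _ | _⟩ := e <;> simp [mid] at h <;> omega
    · rw [injective_mid h] at ho
      simp [dual, ho] at ho'

lemma half_le_coins_NoH_zero (n : ℤ) : 1 / 2 ≤ coins.real (NoH 0 (n + 1) 0 n) := by
  have hm : MeasurableSet (NoH 0 (n + 1) 0 n) :=
    (detBy_noCross _ _ _).measurableSet (finite_edgesIn (finite_rect _ _ _ _))
  have h := measurePreserving_dual.measureReal_preimage hm.nullMeasurableSet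
  have h1 : (Set.univ : Set Config) ⊆ NoH 0 (n + 1) 0 n ∪ dual ⁻¹' NoH 0 (n + 1) 0 n :=
    fun ω _ => mem_NoH_or_dual_mem_NoH ω
  have h2 := (measureReal_mono (μ := coins) h1).trans (measureReal_union_le _ _)
  rw [h, probReal_univ] at h2
  linarith

lemma half_le_coins_NoH {a b c d : ℤ} (h : b - a = d - c + 1) :
    1 / 2 ≤ coins.real (NoH a b c d) := by
  refine (half_le_coins_NoH_zero (d - c)).trans ((coins_NoH_translate _ _ _ _ a c).trans_eq ?_)
  congr 2 <;> omega

lemma half_le_coins_NoV {a b c d : ℤ} (h : d - c = b - a + 1) :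
    1 / 2 ≤ coins.real (NoV a b c d) :=
  (half_le_coins_NoH h).trans (coins_NoH_le_NoV _ _ _ _)

lemma Path.vertical {A : Set (ℤ × ℤ)} {x y z : ℤ} (h : y ≤ z)
    (hA : ∀ k, y ≤ k → k ≤ z → (x, k) ∈ A) : Path A (x, y) (x, z) := by
  induction z, h using Int.leInduction with
  | base => exact .refl
  | succ z hz ih =>
    exact (ih fun k h1 h2 => hA k h1 (by omega)).tail
      ⟨Or.inl ⟨rfl, Or.inl rfl⟩, hA _ hz (by omega), hA _ (by omega) le_rfl⟩

lemma Path.horizontal {A : Set (ℤ × ℤ)} {x z y : ℤ} (h : x ≤ z)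
    (hA : ∀ k, x ≤ k → k ≤ z → (k, y) ∈ A) : Path A (x, y) (z, y) := by
  induction z, h using Int.leInduction with
  | base => exact .refl
  | succ z hz ih =>
    exact (ih fun k h1 h2 => hA k h1 (by omega)).tail
      ⟨Or.inr ⟨rfl, Or.inl rfl⟩, hA _ hz (by omega), hA _ (by omega) le_rfl⟩

/-- The part of the rectangle `[0, 2n] × [0, 2n + 1]` outside `D` and its mirror image. -/
def Outside (n : ℤ) (D : Set (ℤ × ℤ)) : Set (ℤ × ℤ) :=
  {v | v ∈ Rect 0 (2 * n) 0 (2 * n + 1) ∧ v ∉ D ∧ (v.1, 2 * n + 1 - v.2) ∉ D}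

/-- The neighbours of the mirror image of `D`, together with the top side. -/
def UpperTarget (n : ℤ) (D : Set (ℤ × ℤ)) : Set (ℤ × ℤ) :=
  {v | v.2 = 2 * n + 1 ∨ ∃ w ∈ D, Nbr (v.1, 2 * n + 1 - v.2) w}

/-- The neighbours of `D`, together with the bottom side. -/
def LowerTarget (D : Set (ℤ × ℤ)) : Set (ℤ × ℤ) := {v | v.2 = 0 ∨ ∃ w ∈ D, Nbr v w}

lemma outside_subset_rect (n : ℤ) (D : Set (ℤ × ℤ)) :
    Outside n D ⊆ Rect 0 (2 * n) 0 (2 * n + 1) := fun _ h => h.1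

/-- Planarity: paths from the bottom to the mirror image of `D` and from the top to `D` meet. -/
lemma cross_of_cross_targets {n : ℤ} {D : Set (ℤ × ℤ)} {ω : Config}
    (hD : D ⊆ Rect 0 (n + 1) 0 n)
    (hconn : ∀ v ∈ D, ∃ i, (0, i) ∈ D ∧ Path D (0, i) v)
    (h1 : Cross ω (Outside n D) {v | v.2 = 0} (UpperTarget n D))
    (h2 : Cross ω (Outside n D) {v | v.2 = 2 * n + 1} (LowerTarget D)) :
    Cross ω (Rect 0 (2 * n) 0 (2 * n + 1)) {v | v.2 = 0} {v | v.2 = 2 * n + 1} := by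
  obtain ⟨a, haQ, ha0, a', ha'T, hα⟩ := h1
  obtain ⟨b, hbQ, hb0, b', hb'B, hβ⟩ := h2
  have hQR := outside_subset_rect n D
  simp only [Set.mem_ofPred_eq] at ha0 hb0
  rcases ha'T with ha' | ⟨w, hwD, hw⟩
  · exact ⟨a, hQR haQ, ha0, a', ha', hα.mono le_rfl hQR⟩
  rcases hb'B with hb' | ⟨z, hzD, hz⟩
  · exact Cross.symm ⟨b, hQR hbQ, hb0, b', hb', hβ.mono le_rfl hQR⟩
  obtain ⟨i, hiD, hi⟩ := hconn w hwD
  obtain ⟨j, hjD, hj⟩ := hconn z hzD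
  suffices h : ∃ v, Conn ω (Outside n D) a v ∧ Conn ω (Outside n D) b v by
    obtain ⟨v, hav, hbv⟩ := h
    exact ⟨a, hQR haQ, ha0, b, hb0, (hav.trans hbv.symm).mono le_rfl hQR⟩
  have hiS := hD hiD
  have hjS := hD hjD
  have haR := hQR haQ
  have hbR := hQR hbQ
  simp only [Rect, Set.mem_ofPred_eq] at hiS hjS haR hbR
  set A : Set (ℤ × ℤ) := {v | Conn ω (Outside n D) a v ∨ (v.1, 2 * n + 1 - v.2) ∈ D ∨
    (-2 ≤ v.1 ∧ v.1 ≤ -1 ∧ n + 1 ≤ v.2 ∧ v.2 ≤ 2 * n + 1) ∨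
    (0 ≤ v.1 ∧ v.1 ≤ 2 * n + 1 ∧ v.2 = -1)} with hA
  set B : Set (ℤ × ℤ) := {v | Conn ω (Outside n D) b v ∨ v ∈ D ∨
    (v.1 = -1 ∧ -1 ≤ v.2 ∧ v.2 ≤ n) ∨ (0 ≤ v.1 ∧ v.1 ≤ 2 * n ∧ v.2 = 2 * n + 2)} with hB
  have pA1 : Path A (-2, 2 * n + 1 - i) (-1, 2 * n + 1 - i) :=
    Path.horizontal (by omega) fun k h1 h2 =>
      Or.inr (Or.inr (Or.inl ⟨h1, h2, by dsimp only; omega, by dsimp only; omega⟩))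
  have pA2 : Path A (0, 2 * n + 1 - i) (w.1, 2 * n + 1 - w.2) := by
    clear hwD hw
    induction hi with
    | refl => exact .refl
    | @tail x y h1 h2 ih =>
      refine ih.tail ⟨?_, Or.inr (Or.inl ?_), Or.inr (Or.inl ?_)⟩
      · have := h2.1
        simp only [Nbr] at this ⊢
        omega
      · simpa using h2.2.1
      · simpa using h2.2.2
  have hwA : (w.1, 2 * n + 1 - w.2) ∈ A := Or.inr (Or.inl (by simpa using hwD))
  have pA3 : Path A a a' := (hα.of_forall_mem (B := A) fun _ h => Or.inl h).path
  have pA4 : Path A (a.1, -1) (2 * n + 1, -1) :=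
    Path.horizontal (by omega) fun k h1 h2 => Or.inr (Or.inr (Or.inr
      ⟨by dsimp only; omega, h2, rfl⟩))
  have pA : Path A (-2, 2 * n + 1 - i) (2 * n + 1, -1) := by
    refine ((((pA1.tail ⟨?_, ?_, ?_⟩).trans pA2).tail ⟨?_, hwA, Or.inl hα⟩).trans
      (pA3.symm.tail ⟨?_, Or.inl .refl, ?_⟩)).trans pA4
    · exact Or.inr ⟨rfl, Or.inl rfl⟩
    · exact Or.inr (Or.inr (Or.inl (by dsimp only; omega)))
    · exact Or.inr (Or.inl (by simpa using hiD))
    · simp only [Nbr] at hw ⊢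
      omega
    · exact Or.inl ⟨rfl, Or.inr (by dsimp only; omega)⟩
    · exact Or.inr (Or.inr (Or.inr (by dsimp only; omega)))
  have pB1 : Path B (-1, -1) (-1, j) := Path.vertical (by omega) fun k h1 h2 =>
    Or.inr (Or.inr (Or.inl ⟨rfl, h1, by dsimp only; omega⟩))
  have pB2 : Path B (0, j) z := hj.mono fun _ h => Or.inr (Or.inl h)
  have pB3 : Path B b b' := (hβ.of_forall_mem (B := B) fun _ h => Or.inl h).path
  have pB : Path B (-1, -1) (b.1, 2 * n + 2) := by
    refine (((pB1.tail ⟨?_, ?_, Or.inr (Or.inl hjD)⟩).trans pB2).tail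
      ⟨hz.symm, Or.inr (Or.inl hzD), Or.inl hβ⟩).trans
      (pB3.symm.tail ⟨?_, Or.inl .refl, ?_⟩)
    · exact Or.inr ⟨rfl, Or.inl rfl⟩
    · exact Or.inr (Or.inr (Or.inl ⟨rfl, by dsimp only; omega, by dsimp only; omega⟩))
    · exact Or.inl ⟨rfl, Or.inl (by dsimp only; omega)⟩
    · exact Or.inr (Or.inr (Or.inr (by dsimp only; omega)))
  have hBx : ∀ v ∈ B, -2 < v.1 ∧ v.1 ≤ 2 * n + 1 := by
    rintro v (h | h | h | h)
    · have := hQR (h.mem hbQ)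
      simp only [Rect, Set.mem_ofPred_eq] at this
      omega
    · have := hD h
      simp only [Rect, Set.mem_ofPred_eq] at this
      omega
    all_goals omega
  obtain ⟨v, hvA, hvB⟩ := pA.inter_nonempty pB (c := -1) (d := 2 * n + 1)
    (Or.inr (Or.inr (Or.inl (by dsimp only; omega)))) (by
      rintro v (h | h | h | h)
      · have := hQR (h.mem haQ)
        simp only [Rect, Set.mem_ofPred_eq] at this
        omega
      · have := hD h
        simp only [Rect, Set.mem_ofPred_eq] at this
        omega
      all_goals omega) (fun v hv => (hBx v hv).1) (fun v hv => (hBx v hv).2) le_rfl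
      (by dsimp only; omega)
  rcases hvA with hA | hA | hA | hA
  · rcases hvB with hB | hB | hB | hB
    · exact ⟨v, hA, hB⟩
    · exact absurd hB (hA.mem haQ).2.1
    all_goals
      have := hQR (hA.mem haQ)
      simp only [Rect, Set.mem_ofPred_eq] at this
      omega
  · rcases hvB with hB | hB | hB | hB
    · exact absurd hA (hB.mem hbQ).2.2
    · have h1 := hD hA
      have h2 := hD hB
      simp only [Rect, Set.mem_ofPred_eq] at h1 h2
      omega
    all_goals
      have := hD hA
      simp only [Rect, Set.mem_ofPred_eq] at this
      omega
  all_goals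
    rcases hvB with hB | hB | hB | hB
    · have := hQR (hB.mem hbQ)
      simp only [Rect, Set.mem_ofPred_eq] at this
      omega
    · have := hD hB
      simp only [Rect, Set.mem_ofPred_eq] at this
      omega
    all_goals omega

lemma coins_NoV_le_two_mul {n : ℤ} {D : Set (ℤ × ℤ)} (hD : D ⊆ Rect 0 (n + 1) 0 n)
    (hconn : ∀ v ∈ D, ∃ i, (0, i) ∈ D ∧ Path D (0, i) v) :
    coins.real (NoV 0 (2 * n) 0 (2 * n + 1)) ≤
      2 * coins.real (NoCross (Outside n D) {v | v.2 = 0} (UpperTarget n D)) := by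
  have h1 : NoV 0 (2 * n) 0 (2 * n + 1) ⊆
      NoCross (Outside n D) {v | v.2 = 0} (UpperTarget n D) ∪
      NoCross (Outside n D) {v | v.2 = 2 * n + 1} (LowerTarget D) := by
    intro ω hω
    by_contra hc
    simp only [Set.mem_union, not_or, NoCross, Set.mem_ofPred_eq, not_not] at hc
    exact hω (cross_of_cross_targets hD hconn hc.1 hc.2)
  have h2 : coins.real (NoCross (Outside n D) {v | v.2 = 2 * n + 1} (LowerTarget D)) ≤
      coins.real (NoCross (Outside n D) {v | v.2 = 0} (UpperTarget n D)) := by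
    refine coins_noCross_le_of_map (induces_reflectYEdge (2 * n + 1))
      (involutive_reflectYEdge _).injective
      ((finite_rect _ _ _ _).subset (outside_subset_rect n D)) ?_ ?_ ?_
    · rintro v ⟨h1, h2, h3⟩
      refine ⟨?_, h3, by simpa using h2⟩
      simp only [Rect, Set.mem_ofPred_eq] at h1 ⊢
      omega
    · intro v _ h
      simp only [Set.mem_ofPred_eq] at h ⊢
      omega
    · rintro v _ (h | h)
      · left
        dsimp only
        omega
      · exact Or.inr h
  have h3 := (measureReal_mono (μ := coins) h1).trans (measureReal_union_le _ _)
  linarith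

/-- The vertices of `[0, n + 1] × [0, n]` connected to its left side. -/
def cluster (n : ℤ) (ω : Config) : Set (ℤ × ℤ) :=
  {v | ∃ u ∈ Rect 0 (n + 1) 0 n, u.1 = 0 ∧ Conn ω (Rect 0 (n + 1) 0 n) u v}

lemma cluster_subset (n : ℤ) (ω : Config) : cluster n ω ⊆ Rect 0 (n + 1) 0 n :=
  fun _ ⟨_, hu, _, h⟩ => h.mem hu

lemma mem_cluster_of_adj {n : ℤ} {ω : Config} {v w : ℤ × ℤ} (hv : v ∈ cluster n ω)
    (hw : w ∈ Rect 0 (n + 1) 0 n) (h : Adj ω v w) : w ∈ cluster n ω := by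
  obtain ⟨u, hu, hu0, hc⟩ := hv
  exact ⟨u, hu, hu0, hc.tail ⟨h, hc.mem hu, hw⟩⟩

lemma exists_path_cluster {n : ℤ} {ω : Config} {v : ℤ × ℤ} (hv : v ∈ cluster n ω) :
    ∃ i, (0, i) ∈ cluster n ω ∧ Path (cluster n ω) (0, i) v := by
  obtain ⟨⟨x, i⟩, hu, rfl, h⟩ := hv
  exact ⟨i, ⟨_, hu, rfl, .refl⟩,
    (h.of_forall_mem (B := cluster n ω) fun w hw => ⟨_, hu, rfl, hw⟩).path⟩

/-- The edges of `[0, n + 1] × [0, n]` with an endpoint in `D`. -/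
def edgesTouching (n : ℤ) (D : Set (ℤ × ℤ)) : Set Edge :=
  {e | e ∈ edgesIn (Rect 0 (n + 1) 0 n) ∧ (eSrc e ∈ D ∨ eDst e ∈ D)}

lemma Joins.mem_edgesTouching {n : ℤ} {D : Set (ℤ × ℤ)} {e : Edge} {u v : ℤ × ℤ}
    (h : Joins e u v) (hu : u ∈ Rect 0 (n + 1) 0 n) (hv : v ∈ Rect 0 (n + 1) 0 n) (huD : u ∈ D) :
    e ∈ edgesTouching n D := by
  refine ⟨h.mem_edgesIn hu hv, ?_⟩
  obtain ⟨rfl, rfl⟩ | ⟨rfl, rfl⟩ := h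
  exacts [Or.inl huD, Or.inr huD]

lemma detBy_cluster (n : ℤ) (D : Set (ℤ × ℤ)) :
    DetBy {ω | cluster n ω = D} (edgesTouching n D) := by
  rintro ω ω' hω (rfl : _ = D)
  refine Set.Subset.antisymm ?_ ?_
  · rintro v ⟨u, hu, hu0, h⟩
    induction h with
    | refl => exact ⟨u, hu, hu0, .refl⟩
    | tail h1 h2 ih =>
      obtain ⟨⟨e, he, ho⟩, ha, hb⟩ := h2
      exact mem_cluster_of_adj ih hb
        ⟨e, he, (hω e (he.mem_edgesTouching ha hb ih)).trans ho⟩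
  · rintro v ⟨u, hu, hu0, h⟩
    induction h with
    | refl => exact ⟨u, hu, hu0, .refl⟩
    | tail h1 h2 ih =>
      obtain ⟨⟨e, he, ho⟩, ha, hb⟩ := h2
      exact mem_cluster_of_adj ih hb
        ⟨e, he, (hω e (he.mem_edgesTouching ha hb ⟨u, hu, hu0, h1⟩)).symm.trans ho⟩

/-- `D` contains the left side of `[0, n + 1] × [0, n]`, avoids its right side and has closed
boundary there, and no open path from the bottom outside `D` reaches the top or the mirror image
of `D`. -/
structure IsBarrier (n : ℤ) (ω : Config) (D : Set (ℤ × ℤ)) : Prop where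
  subset : D ⊆ Rect 0 (n + 1) 0 n
  left : ∀ v ∈ Rect 0 (n + 1) 0 n, v.1 = 0 → v ∈ D
  right : ∀ v ∈ D, v.1 ≠ n + 1
  closed : ∀ v ∈ D, ∀ w ∈ Rect 0 (n + 1) 0 n, Adj ω v w → w ∈ D
  noCross : ω ∈ NoCross (Outside n D) {v | v.2 = 0} (UpperTarget n D)

lemma mem_NoH_iff {n : ℤ} {ω : Config} :
    ω ∈ NoH 0 (n + 1) 0 n ↔ ∀ v ∈ cluster n ω, v.1 ≠ n + 1 := by
  refine ⟨fun h v ⟨u, hu, hu0, hc⟩ hv => h ⟨u, hu, hu0, v, hv, hc⟩, ?_⟩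
  rintro h ⟨u, hu, hu0, v, hv, hc⟩
  exact h v ⟨u, hu, hu0, hc⟩ hv

lemma isBarrier_cluster {n : ℤ} {ω : Config} (h : ω ∈ NoH 0 (n + 1) 0 n)
    (h' : ω ∈ NoCross (Outside n (cluster n ω)) {v | v.2 = 0} (UpperTarget n (cluster n ω))) :
    IsBarrier n ω (cluster n ω) where
  subset := cluster_subset n ω
  left v hv hv0 := ⟨v, hv, hv0, .refl⟩
  right := mem_NoH_iff.1 h
  closed _ hv _ hw := mem_cluster_of_adj hv hw
  noCross := h'

lemma isLowerSet_isBarrier (n : ℤ) : IsLowerSet {ω | ∃ D, IsBarrier n ω D} := by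
  rintro ω ω' hle ⟨D, h⟩
  exact ⟨D, h.subset, h.left, h.right, fun v hv w hw ha => h.closed v hv w hw (ha.mono hle),
    isLowerSet_noCross _ _ _ hle h.noCross⟩

lemma detBy_isBarrier {n : ℤ} (hn : 1 ≤ n) :
    DetBy {ω | ∃ D, IsBarrier n ω D} (edgesIn (Rect 0 (2 * n) 0 (2 * n + 1))) := by
  rintro ω ω' hω ⟨D, h⟩
  refine ⟨D, h.subset, h.left, h.right, ?_, ?_⟩
  · rintro v hv w hw ⟨e, he, ho⟩
    refine h.closed v hv w hw ⟨e, he, (hω e (he.mem_edgesIn ?_ ?_)).trans ho⟩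
    · obtain ⟨h1, h2, h3, h4⟩ := h.subset hv
      exact ⟨h1, by omega, h3, by omega⟩
    · obtain ⟨h1, h2, h3, h4⟩ := hw
      exact ⟨h1, by omega, h3, by omega⟩
  · exact ((detBy_noCross _ _ _).mono (edgesIn_mono (outside_subset_rect n D))) ω ω' hω h.noCross

lemma eighth_le_coins_isBarrier (n : ℤ) :
    1 / 8 ≤ coins.real {ω | ∃ D, IsBarrier n ω D} := by
  have hfin : {D : Set (ℤ × ℤ) | D ⊆ Rect 0 (n + 1) 0 n ∧ ∀ v ∈ D, v.1 ≠ n + 1}.Finite :=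
    (finite_rect 0 (n + 1) 0 n).finite_subsets.subset fun _ h => h.1
  set 𝒟 := hfin.toFinset
  set E : Set (ℤ × ℤ) → Set Config := fun D =>
    NoCross (Outside n D) {v | v.2 = 0} (UpperTarget n D)
  have hdetE : ∀ D, DetBy (E D) (edgesIn (Outside n D)) := fun D => detBy_noCross _ _ _
  have hfinO : ∀ D, (edgesIn (Outside n D)).Finite := fun D =>
    finite_edgesIn ((finite_rect _ _ _ _).subset (outside_subset_rect n D))
  have hfinT : ∀ D, (edgesTouching n D).Finite := fun D =>
    (finite_edgesIn (finite_rect 0 (n + 1) 0 n)).subset fun _ h => h.1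
  have hdisj : ∀ D, Disjoint (edgesTouching n D) (edgesIn (Outside n D)) := fun D =>
    Set.disjoint_left.2 fun e h1 h2 =>
      h1.2.elim (fun h => h2.1.2.1 h) fun h => h2.2.2.1 h
  have hC : ∀ D, MeasurableSet {ω | cluster n ω = D} := fun D =>
    (detBy_cluster n D).measurableSet (hfinT D)
  have hpair : Set.PairwiseDisjoint (↑𝒟 : Set (Set (ℤ × ℤ))) fun D => {ω | cluster n ω = D} := by
    intro D _ D' _ hne
    refine Set.disjoint_left.2 ?_
    rintro ω (rfl : _ = D) (h : _ = D')
    exact hne h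
  have hNoH : NoH 0 (n + 1) 0 n ⊆ ⋃ D ∈ 𝒟, {ω | cluster n ω = D} := by
    intro ω h
    simp only [Set.mem_iUnion]
    exact ⟨cluster n ω, hfin.mem_toFinset.2 ⟨cluster_subset n ω, mem_NoH_iff.1 h⟩, rfl⟩
  have hsub : ⋃ D ∈ 𝒟, {ω | cluster n ω = D} ∩ E D ⊆ {ω | ∃ D, IsBarrier n ω D} := by
    intro ω h
    simp only [Set.mem_iUnion] at h
    obtain ⟨D, hD, rfl, hE⟩ := h
    exact ⟨_, isBarrier_cluster (mem_NoH_iff.2 (hfin.mem_toFinset.1 hD).2) hE⟩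
  have hterm : ∀ D ∈ 𝒟, coins.real {ω | cluster n ω = D} * (1 / 4) ≤
      coins.real ({ω | cluster n ω = D} ∩ E D) := by
    intro D hD
    rw [coins_real_inter_of_disjoint (detBy_cluster n D) (hdetE D) (hfinT D) (hfinO D) (hdisj D)]
    rcases Set.eq_empty_or_nonempty {ω | cluster n ω = D} with h0 | ⟨ω, rfl⟩
    · simp [h0]
    · refine mul_le_mul_of_nonneg_left ?_ measureReal_nonneg
      have h1 := coins_NoV_le_two_mul (cluster_subset n ω) fun v hv => exists_path_cluster hv
      have h2 : 1 / 2 ≤ coins.real (NoV 0 (2 * n) 0 (2 * n + 1)) := half_le_coins_NoV (by ring)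
      show _ ≤ coins.real (NoCross _ _ _)
      linarith
  have h1 : 1 / 2 ≤ ∑ D ∈ 𝒟, coins.real {ω | cluster n ω = D} := by
    rw [← measureReal_biUnion_finset hpair fun D _ => hC D]
    exact (half_le_coins_NoH (by ring)).trans (measureReal_mono hNoH (measure_ne_top _ _))
  have h2 := measureReal_mono (μ := coins) hsub
  rw [measureReal_biUnion_finset
    (hpair.mono fun D => Set.inter_subset_left)
    fun D _ => (hC D).inter ((hdetE D).measurableSet (hfinO D))] at h2
  have h3 := Finset.sum_le_sum hterm
  rw [← Finset.sum_mul] at h3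
  linarith

lemma IsBarrier.not_top {n : ℤ} {ω : Config} {D : Set (ℤ × ℤ)} (h : IsBarrier n ω D)
    {u v : ℤ × ℤ} (hu : u ∈ Rect 0 (2 * n) 0 (2 * n + 1)) (hu0 : u.2 = 0) (huD : u ∉ D)
    (hc : Conn ω (Rect (3 - n) (2 * n) 0 (2 * n + 1)) u v) : v.2 ≠ 2 * n + 1 := by
  have hD : ∀ v ∈ D, 0 ≤ v.1 ∧ v.1 ≤ n + 1 ∧ 0 ≤ v.2 ∧ v.2 ≤ n := fun v hv => h.subset hv
  have huQ : u ∈ Outside n D := by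
    refine ⟨hu, huD, fun hm => ?_⟩
    have := hD _ hm
    dsimp only at this
    omega
  have key : Conn ω (Outside n D) u v := by
    induction hc with
    | refl => exact .refl
    | @tail v w h1 h2 ih =>
      obtain ⟨ha, hv, hw⟩ := h2
      obtain ⟨⟨hv1, hv2, hv3, hv4⟩, hvD, hvD'⟩ := ih.mem huQ
      obtain ⟨hw1, hw2, hw3, hw4⟩ := hw
      have hn := ha.nbr
      unfold Nbr at hn
      have hv0 : v.1 ≠ 0 := by
        intro hv0
        rcases le_or_gt v.2 n with h3 | h3
        · exact hvD (h.left v ⟨by omega, by omega, by omega, by omega⟩ hv0)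
        · refine hvD' (h.left _ ⟨?_, ?_, ?_, ?_⟩ hv0) <;> dsimp only <;> omega
      refine ih.tail ⟨ha, ih.mem huQ, ⟨by omega, hw2, hw3, hw4⟩, fun hwD => ?_, fun hwD => ?_⟩
      · have h3 := hD w hwD
        have h4 := h.right w hwD
        have h5 : ¬ v ∈ Rect 0 (n + 1) 0 n := fun h5 => hvD (h.closed w hwD v h5 ha.symm)
        have h6 : (v.1, 2 * n + 1 - v.2) = w := by
          simp only [Rect, Set.mem_ofPred_eq] at h5
          ext <;> dsimp only <;> omega
        exact hvD' (h6 ▸ hwD)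
      · refine h.noCross ⟨u, huQ, hu0, v, Or.inr ⟨_, hwD, ?_⟩, ih⟩
        simp only [Nbr]
        omega
  exact fun hv => h.noCross ⟨u, huQ, hu0, v, Or.inl hv, key⟩

/-- Two facing barriers trap every path that starts from the bottom. -/
lemma mem_NoV_of_isBarrier {n : ℤ} (hn : 3 ≤ n) {ω : Config} {D E : Set (ℤ × ℤ)}
    (hD : IsBarrier n ω D) (hE : IsBarrier n (ω ∘ reflectXEdge (n + 3)) E)
    (hω : ω ∈ NoV 2 (n + 1) 0 n) : ω ∈ NoV (3 - n) (2 * n) 0 (2 * n + 1) := by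
  rintro ⟨u, hu, hu0, v, hv, hc⟩
  simp only [Set.mem_ofPred_eq] at hu0 hv
  have hD' : ∀ v ∈ D, 0 ≤ v.1 ∧ v.1 ≤ n + 1 ∧ 0 ≤ v.2 ∧ v.2 ≤ n := fun v hv => hD.subset hv
  have hE' : ∀ v ∈ E, 0 ≤ v.1 ∧ v.1 ≤ n + 1 ∧ 0 ≤ v.2 ∧ v.2 ≤ n := fun v hv => hE.subset hv
  have hinv : (ω ∘ reflectXEdge (n + 3)) ∘ reflectXEdge (n + 3) = ω := by
    ext e
    simp [involutive_reflectXEdge (n + 3) e]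
  obtain ⟨hu1, hu2, hu3, hu4⟩ := hu
  have huD : u ∈ Rect 0 (2 * n) 0 (2 * n + 1) → u ∈ D := fun h => by
    by_contra huD
    exact hD.not_top h hu0 huD hc hv
  have huE : (n + 3 - u.1, u.2) ∈ Rect 0 (2 * n) 0 (2 * n + 1) → (n + 3 - u.1, u.2) ∈ E := by
    intro h
    by_contra huE
    rw [← hinv] at hc
    refine hE.not_top h hu0 huE (hc.map (induces_reflectXEdge (n + 3))
      (A' := Rect (3 - n) (2 * n) 0 (2 * n + 1)) ?_) hv
    rintro w ⟨h1, h2, h3⟩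
    exact ⟨by dsimp only; omega, by dsimp only; omega, h3⟩
  simp only [Rect, Set.mem_ofPred_eq] at huD huE
  have huD : u ∈ D := by
    by_cases h : 0 ≤ u.1
    · exact huD ⟨h, by omega⟩
    · have := hE' _ (huE (by omega))
      dsimp only at this
      omega
  have huE : (n + 3 - u.1, u.2) ∈ E := by
    have := hD' _ huD
    exact huE (by omega)
  have huR : u ∈ Rect 2 (n + 1) 0 n := by
    have h1 := hD' _ huD
    have h2 := hE' _ huE
    refine ⟨?_, ?_, ?_, ?_⟩ <;> dsimp only at h2 <;> omega
  have key : v ∈ D ∧ (n + 3 - v.1, v.2) ∈ E ∧ Conn ω (Rect 2 (n + 1) 0 n) u v := by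
    clear hv
    induction hc with
    | refl => exact ⟨huD, huE, .refl⟩
    | @tail v w h1 h2 ih =>
      obtain ⟨ha, -, hw1, hw2, hw3, hw4⟩ := h2
      obtain ⟨hvD, hvE, hvc⟩ := ih
      have h3 := hD' _ hvD
      have h4 := hE' _ hvE
      have h5 := hD.right _ hvD
      have h6 := hE.right _ hvE
      have hn := ha.nbr
      unfold Nbr at hn
      dsimp only at h4 h6
      have hvn : ¬ (v.2 = n) := fun hvn => hω ⟨u, huR, hu0, v, hvn, hvc⟩
      have hwD : w ∈ D := hD.closed v hvD w ⟨by omega, by omega, by omega, by omega⟩ ha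
      refine ⟨hwD, ?_, hvc.tail ⟨ha, ⟨by omega, by omega, by omega, by omega⟩,
        by omega, by omega, by omega, by omega⟩⟩
      refine hE.closed _ hvE _ ⟨?_, ?_, ?_, ?_⟩ ?_ <;> try (dsimp only; omega)
      obtain ⟨e, he, ho⟩ := ha
      refine ⟨reflectXEdge (n + 3) e, induces_reflectXEdge _ _ _ _ he, ?_⟩
      simpa [involutive_reflectXEdge (n + 3) e] using ho
  have := hD' _ key.1
  omega

lemma DetBy.comp {E : Set Config} {F : Set Edge} (h : DetBy E F) (σ : Edge → Edge) :
    DetBy ((fun ω : Config => ω ∘ σ) ⁻¹' E) (σ '' F) :=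
  fun _ _ hω => h _ _ fun e he => hω (σ e) ⟨e, he, rfl⟩

lemma le_coins_NoV_wide {n : ℤ} (hn : 3 ≤ n) :
    1 / 128 ≤ coins.real (NoV (3 - n) (2 * n) 0 (2 * n + 1)) := by
  set X : Set Config := {ω | ∃ D, IsBarrier n ω D}
  set σ := reflectXEdge (n + 3)
  set Y : Set Config := (fun ω : Config => ω ∘ σ) ⁻¹' X
  have hX := detBy_isBarrier (n := n) (by omega)
  have hXf := finite_edgesIn (finite_rect 0 (2 * n) 0 (2 * n + 1))
  have hY : DetBy Y _ := hX.comp σ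
  have hV := detBy_noCross (Rect 2 (n + 1) 0 n) {v | v.2 = 0} {v | v.2 = n}
  have hVf := finite_edgesIn (finite_rect 2 (n + 1) 0 n)
  have hXl := isLowerSet_isBarrier n
  have hYl : IsLowerSet Y := fun ω ω' hle h => hXl (fun e => hle (σ e)) h
  have hsub : X ∩ Y ∩ NoV 2 (n + 1) 0 n ⊆ NoV (3 - n) (2 * n) 0 (2 * n + 1) := by
    rintro ω ⟨⟨⟨D, hD⟩, E, hE⟩, h⟩
    exact mem_NoV_of_isBarrier hn hD hE h
  have h1 := coins_real_mul_le_inter hX hY hXf (hXf.image _) hXl hYl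
  have h2 := coins_real_mul_le_inter
    ((hX.mono Set.subset_union_left).inter (hY.mono Set.subset_union_right)) hV
    (hXf.union (hXf.image _)) hVf (hXl.inter hYl) (isLowerSet_noCross _ _ _)
  have h3 : 1 / 8 ≤ coins.real X := eighth_le_coins_isBarrier n
  have h4 : coins.real Y = coins.real X :=
    (measurePreserving_comp (involutive_reflectXEdge (n + 3)).injective).measureReal_preimage
      (hX.measurableSet hXf).nullMeasurableSet
  have h5 : 1 / 2 ≤ coins.real (NoV 2 (n + 1) 0 n) := half_le_coins_NoV (by ring)
  rw [h4] at h1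
  have h6 : (1 / 8 : ℝ) * (1 / 8) ≤ coins.real X * coins.real X := by gcongr
  have h7 : (1 / 64 : ℝ) * (1 / 2) ≤ coins.real (X ∩ Y) * coins.real (NoV 2 (n + 1) 0 n) := by
    gcongr
    linarith
  have h8 := measureReal_mono (μ := coins) hsub
  have h9 : coins.real (X ∩ Y) * coins.real (NoV 2 (n + 1) 0 n) ≤
    coins.real (X ∩ Y ∩ NoV 2 (n + 1) 0 n) := h2
  linarith

lemma le_coins_NoV_glue {w h : ℤ} (hh : 0 ≤ h) {c : ℝ} (hc0 : 0 ≤ c)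
    (hc : c ≤ coins.real (NoV 0 w 0 h)) :
    c ^ 2 / 2 ≤ coins.real (NoV 0 (2 * w - h - 1) 0 h) := by
  have h1 : c ≤ coins.real (NoV (w - h - 1) (2 * w - h - 1) 0 h) := by
    refine hc.trans ((coins_NoV_translate _ _ _ _ (w - h - 1) 0).trans_eq ?_)
    congr 2 <;> ring
  have h2 : 1 / 2 ≤ coins.real (NoH (w - h - 1) w 0 h) := half_le_coins_NoH (by ring)
  have hfin : ∀ a b : ℤ, (edgesIn (Rect a b 0 h)).Finite := fun a b =>
    finite_edgesIn (finite_rect _ _ _ _)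
  have hdet : ∀ a b : ℤ, DetBy (NoV a b 0 h) (edgesIn (Rect a b 0 h)) := fun _ _ =>
    detBy_noCross _ _ _
  have h3 := coins_real_mul_le_inter (hdet 0 w) (hdet (w - h - 1) (2 * w - h - 1)) (hfin _ _)
    (hfin _ _) (isLowerSet_noCross _ _ _) (isLowerSet_noCross _ _ _)
  have h4 := coins_real_mul_le_inter
    (((hdet 0 w).mono Set.subset_union_left).inter
      ((hdet (w - h - 1) (2 * w - h - 1)).mono Set.subset_union_right))
    (detBy_noCross (Rect (w - h - 1) w 0 h) {v | v.1 = w - h - 1} {v | v.1 = w})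
    ((hfin _ _).union (hfin _ _)) (hfin _ _)
    ((isLowerSet_noCross _ _ _).inter (isLowerSet_noCross _ _ _)) (isLowerSet_noCross _ _ _)
  have h5 := measureReal_mono (μ := coins) (NoV_glue (a := 0) (a' := w - h - 1) (b' := w)
    (b := 2 * w - h - 1) (c := 0) (d := h) (by omega))
  refine le_trans ?_ (h4.trans h5)
  have h6 : c * c ≤ coins.real (NoV 0 w 0 h ∩ NoV (w - h - 1) (2 * w - h - 1) 0 h) :=
    le_trans (by gcongr) h3
  calc c ^ 2 / 2 = c * c * (1 / 2) := by ring
    _ ≤ _ := by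
      refine mul_le_mul h6 h2 (by norm_num) measureReal_nonneg

/-- The Russo–Seymour–Welsh estimate, in the form needed for blocking annuli. -/
lemma exists_le_coins_NoV : ∃ c : ℝ, 0 < c ∧ ∀ l a b k m : ℤ, 0 ≤ l → b - a = 6 * l + 42 →
    m - k = 2 * l + 21 → c ≤ coins.real (NoV a b k m) := by
  refine ⟨((1 / 128) ^ 2 / 2) ^ 2 / 2, by norm_num, fun l a b k m hl hb hm => ?_⟩
  have h1 : (1 / 128 : ℝ) ≤ coins.real (NoV 0 (3 * l + 27) 0 (2 * l + 21)) := by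
    refine (le_coins_NoV_wide (n := l + 10) (by omega)).trans
      ((coins_NoV_translate _ _ _ _ (l + 7) 0).trans_eq ?_)
    congr 2 <;> ring
  have h2 := le_coins_NoV_glue (by omega) (by norm_num) h1
  have h3 := le_coins_NoV_glue (by omega) (by norm_num) h2
  refine h3.trans ((coins_NoV_translate _ _ _ _ a k).trans_eq ?_)
  congr 2 <;> linarith

/-- The supremum norm on `ℤ²`. -/
def supNorm (v : ℤ × ℤ) : ℤ := max |v.1| |v.2|

lemma supNorm_le_iff {v : ℤ × ℤ} {m : ℤ} :
    supNorm v ≤ m ↔ -m ≤ v.1 ∧ v.1 ≤ m ∧ -m ≤ v.2 ∧ v.2 ≤ m := by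
  rw [supNorm, max_le_iff, abs_le, abs_le, and_assoc]

lemma le_supNorm_iff {v : ℤ × ℤ} {m : ℤ} :
    m ≤ supNorm v ↔ (m ≤ v.1 ∨ m ≤ -v.1) ∨ (m ≤ v.2 ∨ m ≤ -v.2) := by
  rw [supNorm, le_max_iff, le_abs, le_abs]

lemma finite_supNorm_le (m : ℤ) : {v | supNorm v ≤ m}.Finite :=
  (finite_rect (-m) m (-m) m).subset fun _ h => supNorm_le_iff.1 h

lemma supNorm_le_of_nbr {u v : ℤ × ℤ} (h : Nbr u v) : supNorm v ≤ supNorm u + 1 := by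
  have := supNorm_le_iff.1 (le_refl (supNorm u))
  rw [supNorm_le_iff]
  unfold Nbr at h
  omega

/-- No open path crosses one of the four rectangles of the annulus
`l ≤ supNorm ≤ 3 * l + 21` in the short direction. -/
def Blocked (l : ℤ) : Set Config :=
  (NoV (-(3 * l + 21)) (3 * l + 21) l (3 * l + 21) ∩
      NoV (-(3 * l + 21)) (3 * l + 21) (-(3 * l + 21)) (-l)) ∩
    (NoH l (3 * l + 21) (-(3 * l + 21)) (3 * l + 21) ∩
      NoH (-(3 * l + 21)) (-l) (-(3 * l + 21)) (3 * l + 21))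

lemma detBy_blocked {l : ℤ} (hl : 0 ≤ l) :
    DetBy (Blocked l) (edgesIn {v | l ≤ supNorm v ∧ supNorm v ≤ 3 * l + 21}) := by
  refine (DetBy.inter ?_ ?_).inter (DetBy.inter ?_ ?_) <;>
    refine (detBy_noCross _ _ _).mono (edgesIn_mono ?_) <;>
    rintro v ⟨h1, h2, h3, h4⟩ <;>
    simp only [Set.mem_ofPred_eq, supNorm_le_iff, le_supNorm_iff] <;> omega

lemma exists_le_coins_blocked :
    ∃ c : ℝ, 0 < c ∧ ∀ l : ℤ, 0 ≤ l → c ≤ coins.real (Blocked l) := by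
  obtain ⟨c, hc, h⟩ := exists_le_coins_NoV
  refine ⟨c * c * (c * c), by positivity, fun l hl => ?_⟩
  set u := 3 * l + 21 with hu
  have h1 : c ≤ coins.real (NoV (-u) u l u) := h l _ _ _ _ hl (by omega) (by omega)
  have h2 : c ≤ coins.real (NoV (-u) u (-u) (-l)) := h l _ _ _ _ hl (by omega) (by omega)
  have h3 : c ≤ coins.real (NoH l u (-u) u) :=
    (h l _ _ _ _ hl (by omega) (by omega)).trans (coins_NoV_le_NoH _ _ _ _)
  have h4 : c ≤ coins.real (NoH (-u) (-l) (-u) u) :=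
    (h l _ _ _ _ hl (by omega) (by omega)).trans (coins_NoV_le_NoH _ _ _ _)
  have hdet : ∀ {a b k m : ℤ} {P Q : Set (ℤ × ℤ)}, -u ≤ a → b ≤ u → -u ≤ k → m ≤ u →
      DetBy (NoCross (Rect a b k m) P Q) (edgesIn (Rect (-u) u (-u) u)) := by
    intro a b k m P Q ha hb hk hm
    refine (detBy_noCross _ _ _).mono (edgesIn_mono ?_)
    rintro v ⟨h1, h2, h3, h4⟩
    exact ⟨by omega, by omega, by omega, by omega⟩
  have hfin := finite_edgesIn (finite_rect (-u) u (-u) u)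
  have hlow := isLowerSet_noCross
  have d1 : DetBy (NoV (-u) u l u) _ := hdet (by omega) (by omega) (by omega) (by omega)
  have d2 : DetBy (NoV (-u) u (-u) (-l)) _ := hdet (by omega) (by omega) (by omega) (by omega)
  have d3 : DetBy (NoH l u (-u) u) _ := hdet (by omega) (by omega) (by omega) (by omega)
  have d4 : DetBy (NoH (-u) (-l) (-u) u) _ := hdet (by omega) (by omega) (by omega) (by omega)
  have m1 := coins_real_mul_le_inter d1 d2 hfin hfin (hlow _ _ _) (hlow _ _ _)
  have m2 := coins_real_mul_le_inter d3 d4 hfin hfin (hlow _ _ _) (hlow _ _ _)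
  have m3 := coins_real_mul_le_inter (d1.inter d2) (d3.inter d4) hfin hfin
    ((hlow _ _ _).inter (hlow _ _ _)) ((hlow _ _ _).inter (hlow _ _ _))
  refine le_trans ?_ m3
  exact mul_le_mul (le_trans (by gcongr) m1) (le_trans (by gcongr) m2) (by positivity)
    measureReal_nonneg

lemma Conn.not_blocked {ω : Config} {A : Set (ℤ × ℤ)} {v : ℤ × ℤ} {l : ℤ} (hl : 0 ≤ l)
    (h0 : (0, 0) ∈ A) (h : Conn ω A (0, 0) v) (hv : 3 * l + 21 ≤ supNorm v) : ω ∉ Blocked l := by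
  rintro ⟨⟨b1, b2⟩, b3, b4⟩
  obtain ⟨u, hu, hul, w, hw, hc⟩ := h.cross_strip supNorm (fun _ _ => supNorm_le_of_nbr)
    (l := l) (m := 3 * l + 21) (by omega) h0 (by simpa [supNorm] using hl) hv
  have hul' := supNorm_le_iff.1 (le_of_eq hul)
  have hsub : ∀ w ∈ {w | w ∈ A ∧ l ≤ supNorm w ∧ supNorm w ≤ 3 * l + 21},
      -(3 * l + 21) ≤ w.1 ∧ w.1 ≤ 3 * l + 21 ∧ -(3 * l + 21) ≤ w.2 ∧ w.2 ≤ 3 * l + 21 :=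
    fun w hw => supNorm_le_iff.1 hw.2.2
  rcases le_supNorm_iff.1 (ge_of_eq hw) with (h | h) | (h | h)
  · refine b3 ((hc.cross_strip Prod.fst (fun u v h => by unfold Nbr at h; omega)
      (l := l) (m := 3 * l + 21) (by omega) hu (by omega) h).mono le_rfl ?_
      Set.inter_subset_right Set.inter_subset_right)
    rintro x ⟨hx, h1, h2⟩
    have := hsub x hx
    exact ⟨h1, h2, this.2.2⟩
  · refine b4 ((hc.cross_strip (fun v => -v.1) (fun u v h => by unfold Nbr at h; omega)
      (l := l) (m := 3 * l + 21) (by omega) hu (by omega) h).symm.mono le_rfl ?_ ?_ ?_)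
    · rintro x ⟨hx, h1, h2⟩
      have := hsub x hx
      exact ⟨by omega, by omega, this.2.2⟩
    all_goals
      rintro x ⟨-, h1⟩
      simp only [Set.mem_ofPred_eq] at h1 ⊢
      omega
  · refine b1 ((hc.cross_strip Prod.snd (fun u v h => by unfold Nbr at h; omega)
      (l := l) (m := 3 * l + 21) (by omega) hu (by omega) h).mono le_rfl ?_
      Set.inter_subset_right Set.inter_subset_right)
    rintro x ⟨hx, h1, h2⟩
    have := hsub x hx
    exact ⟨this.1, this.2.1, h1, h2⟩
  · refine b2 ((hc.cross_strip (fun v => -v.2) (fun u v h => by unfold Nbr at h; omega)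
      (l := l) (m := 3 * l + 21) (by omega) hu (by omega) h).symm.mono le_rfl ?_ ?_ ?_)
    · rintro x ⟨hx, h1, h2⟩
      have := hsub x hx
      exact ⟨this.1, this.2.1, by omega, by omega⟩
    all_goals
      rintro x ⟨-, h1⟩
      simp only [Set.mem_ofPred_eq] at h1 ⊢
      omega

/-- The inner radii of a sequence of disjoint annuli. -/
def radius : ℕ → ℤ
  | 0 => 0
  | k + 1 => 3 * radius k + 22

lemma radius_nonneg (k : ℕ) : 0 ≤ radius k := by
  induction k with
  | zero => exact le_rfl
  | succ k ih => rw [radius]; omega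

lemma radius_mono : Monotone radius :=
  monotone_nat_of_le_succ fun k => by have := radius_nonneg k; rw [radius]; omega

lemma coins_forall_not_blocked_le {c : ℝ} (hc : ∀ l : ℤ, 0 ≤ l → c ≤ coins.real (Blocked l))
    (K : ℕ) : coins.real {ω | ∀ k < K, ω ∉ Blocked (radius k)} ≤ (1 - c) ^ K := by
  have hc1 : c ≤ 1 := (hc 0 le_rfl).trans measureReal_le_one
  have hdet : ∀ K, DetBy {ω | ∀ k < K, ω ∉ Blocked (radius k)}
      (edgesIn {v | supNorm v ≤ radius K - 1}) := by
    intro K ω ω' hω h k hk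
    refine ((detBy_blocked (radius_nonneg k)).mono (edgesIn_mono ?_)).compl ω ω' hω (h k hk)
    rintro v ⟨-, hv⟩
    have : radius (k + 1) ≤ radius K := radius_mono hk
    rw [radius] at this
    simp only [Set.mem_ofPred_eq]
    omega
  induction K with
  | zero => simp
  | succ K ih =>
    have hfin : (edgesIn {v | radius K ≤ supNorm v ∧ supNorm v ≤ 3 * radius K + 21}).Finite :=
      finite_edgesIn ((finite_supNorm_le _).subset fun _ h => h.2)
    have heq : {ω | ∀ k < K + 1, ω ∉ Blocked (radius k)} =
        {ω | ∀ k < K, ω ∉ Blocked (radius k)} ∩ (Blocked (radius K))ᶜ := by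
      ext ω
      simp only [Set.mem_ofPred_eq, Set.mem_inter_iff, Set.mem_compl_iff, Nat.lt_succ_iff_lt_or_eq]
      exact ⟨fun h => ⟨fun k hk => h k (Or.inl hk), h K (Or.inr rfl)⟩,
        fun h k hk => hk.elim (h.1 k) fun e => e ▸ h.2⟩
    rw [heq, coins_real_inter_of_disjoint (hdet K) (detBy_blocked (radius_nonneg K)).compl
      (finite_edgesIn (finite_supNorm_le _)) hfin, pow_succ,
      probReal_compl_eq_one_sub ((detBy_blocked (radius_nonneg K)).measurableSet hfin)]
    · have := hc _ (radius_nonneg K)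
      have h1 : coins.real (Blocked (radius K)) ≤ 1 := measureReal_le_one
      exact mul_le_mul ih (by linarith) (by linarith) (pow_nonneg (by linarith) _)
    · refine Set.disjoint_left.2 fun e h1 h2 => ?_
      have h3 := h1.1
      have h4 := h2.1
      simp only [Set.mem_ofPred_eq] at h3 h4
      omega

/-- Connections of the origin to large distances are unlikely in bond percolation. -/
lemma coins_conn_le {c : ℝ} (hc : ∀ l : ℤ, 0 ≤ l → c ≤ coins.real (Blocked l)) (K : ℕ) :
    coins.real {ω | ∃ v, Conn ω Set.univ (0, 0) v ∧ radius K ≤ supNorm v} ≤ (1 - c) ^ K := by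
  refine le_trans (measureReal_mono ?_) (coins_forall_not_blocked_le hc K)
  rintro ω ⟨v, hv, hK⟩ k hk
  refine hv.not_blocked (radius_nonneg k) (Set.mem_univ _) ?_
  have : radius (k + 1) ≤ radius K := radius_mono hk
  rw [radius] at this
  omega

open Relation

section
variable {α : Type*} {R : α → α → Prop} {o a b v : α} {p q p' q' : Prop}

/-- The relation `R` with the arc from `a` to `b` added if `p` holds, and the reverse arc added
if `q` holds. -/
def AddArcs (R : α → α → Prop) (a b : α) (p q : Prop) (u v : α) : Prop :=
  R u v ∨ (p ∧ u = a ∧ v = b) ∨ (q ∧ u = b ∧ v = a)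

lemma reflTransGen_addArcs (h : ReflTransGen R o v) : ReflTransGen (AddArcs R a b p q) o v :=
  ReflTransGen.mono (fun _ _ h => Or.inl h) _ _ h

lemma reflTransGen_addArcs_of_fst (ha : ReflTransGen R o a)
    (h : ReflTransGen (AddArcs R a b p q) o v) : ReflTransGen (AddArcs R a b p q') o v := by
  induction h with
  | refl => exact .refl
  | tail _ h ih =>
    rcases h with h | h | ⟨-, rfl, rfl⟩
    · exact ih.tail (Or.inl h)
    · exact ih.tail (Or.inr (Or.inl h))
    · exact reflTransGen_addArcs ha

lemma reflTransGen_addArcs_of_snd (hb : ReflTransGen R o b)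
    (h : ReflTransGen (AddArcs R a b p q) o v) : ReflTransGen (AddArcs R a b p' q) o v := by
  induction h with
  | refl => exact .refl
  | tail _ h ih =>
    rcases h with h | ⟨-, rfl, rfl⟩ | h
    · exact ih.tail (Or.inl h)
    · exact reflTransGen_addArcs hb
    · exact ih.tail (Or.inr (Or.inr h))

lemma reflTransGen_of_addArcs (ha : ¬ ReflTransGen R o a) (hb : ¬ ReflTransGen R o b)
    (h : ReflTransGen (AddArcs R a b p q) o v) : ReflTransGen R o v := by
  induction h with
  | refl => exact .refl
  | tail _ h ih =>
    rcases h with h | ⟨-, rfl, rfl⟩ | ⟨-, rfl, rfl⟩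
    · exact ih.tail h
    · exact absurd ih ha
    · exact absurd ih hb

end

/-- The edge `e` can be traversed from `u` to `v`, where the edges in `F` are open or closed
as in bond percolation, and the other edges are oriented. -/
def Arc (F : Set Edge) (ω : Config) (e : Edge) (u v : ℤ × ℤ) : Prop :=
  (eSrc e = u ∧ eDst e = v ∧ ω e = true) ∨
    (eSrc e = v ∧ eDst e = u ∧ (ω e = true ↔ e ∈ F))

/-- Steps along edges in `U` from vertices in `Λ`. -/
def HybridStep (Λ : Set (ℤ × ℤ)) (U F : Set Edge) (ω : Config) (u v : ℤ × ℤ) : Prop :=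
  u ∈ Λ ∧ ∃ e ∈ U, Arc F ω e u v

/-- Some vertex outside `Λ` is reachable from the origin. -/
def Escape (Λ : Set (ℤ × ℤ)) (F : Set Edge) : Set Config :=
  {ω | ∃ v ∉ Λ, ReflTransGen (HybridStep Λ Set.univ F ω) (0, 0) v}

/-- The edges with an endpoint in `Λ`. -/
def edgesAt (Λ : Set (ℤ × ℤ)) : Set Edge := {e | eSrc e ∈ Λ ∨ eDst e ∈ Λ}

lemma finite_edgesAt {Λ : Set (ℤ × ℤ)} (h : Λ.Finite) : (edgesAt Λ).Finite := by
  refine (((h.prod (Set.finite_univ (α := Bool)))).union ((h.image fun v => (v.1 - 1, v.2)).union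
    (h.image fun v => (v.1, v.2 - 1)) |>.prod (Set.finite_univ (α := Bool)))).subset ?_
  rintro ⟨⟨x, y⟩, _ | _⟩ (he | he)
  · exact Or.inl ⟨he, trivial⟩
  · exact Or.inr ⟨Or.inl ⟨_, he, by simp [eDst]⟩, trivial⟩
  · exact Or.inl ⟨he, trivial⟩
  · exact Or.inr ⟨Or.inr ⟨_, he, by simp [eDst]⟩, trivial⟩

lemma HybridStep.congr {Λ : Set (ℤ × ℤ)} {U F F' : Set Edge} {ω ω' : Config}
    (hω : ∀ e ∈ edgesAt Λ ∩ U, ω e = ω' e) (hF : ∀ e ∈ U, e ∈ F ↔ e ∈ F') {u v : ℤ × ℤ}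
    (h : HybridStep Λ U F ω u v) : HybridStep Λ U F' ω' u v := by
  obtain ⟨hu, e, heU, he⟩ := h
  have : ω e = ω' e := by
    refine hω e ⟨?_, heU⟩
    obtain ⟨rfl, rfl, -⟩ | ⟨rfl, rfl, -⟩ := he
    exacts [Or.inl hu, Or.inr hu]
  refine ⟨hu, e, heU, ?_⟩
  rwa [Arc, ← this, ← hF e heU]

lemma hybridStep_eq_addArcs (Λ : Set (ℤ × ℤ)) (F : Set Edge) (ω : Config) (e : Edge) :
    HybridStep Λ Set.univ F ω = AddArcs (HybridStep Λ {e}ᶜ F ω) (eSrc e) (eDst e)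
      (eSrc e ∈ Λ ∧ ω e = true) (eDst e ∈ Λ ∧ (ω e = true ↔ e ∈ F)) := by
  ext u v
  constructor
  · rintro ⟨hu, e', -, he⟩
    by_cases h : e' = e
    · subst h
      obtain ⟨rfl, rfl, ho⟩ | ⟨rfl, rfl, ho⟩ := he
      exacts [Or.inr (Or.inl ⟨⟨hu, ho⟩, rfl, rfl⟩), Or.inr (Or.inr ⟨⟨hu, ho⟩, rfl, rfl⟩)]
    · exact Or.inl ⟨hu, e', h, he⟩
  · rintro (⟨hu, e', -, he⟩ | ⟨⟨hu, ho⟩, rfl, rfl⟩ | ⟨⟨hu, ho⟩, rfl, rfl⟩)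
    exacts [⟨hu, e', trivial, he⟩, ⟨hu, e, trivial, Or.inl ⟨rfl, rfl, ho⟩⟩,
      ⟨hu, e, trivial, Or.inr ⟨rfl, rfl, ho⟩⟩]

/-- The vertex `v` is reachable without using the edge `e`. -/
def ReachAvoiding (Λ : Set (ℤ × ℤ)) (F : Set Edge) (e : Edge) (v : ℤ × ℤ) : Set Config :=
  {ω | ReflTransGen (HybridStep Λ {e}ᶜ F ω) (0, 0) v}

lemma detBy_reachAvoiding (Λ : Set (ℤ × ℤ)) (F : Set Edge) (e : Edge) (v : ℤ × ℤ) :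
    DetBy (ReachAvoiding Λ F e v) (edgesAt Λ ∩ {e}ᶜ) := fun _ _ hω h =>
  ReflTransGen.mono (fun _ _ h => HybridStep.congr hω (fun _ _ => Iff.rfl) h) _ _ h

lemma detBy_escape (Λ : Set (ℤ × ℤ)) (F : Set Edge) : DetBy (Escape Λ F) (edgesAt Λ) :=
  fun _ _ hω ⟨v, hv, h⟩ => ⟨v, hv, ReflTransGen.mono
    (fun _ _ h => HybridStep.congr (fun e he => hω e he.1) (fun _ _ => Iff.rfl) h) _ _ h⟩

/-- Turning the oriented edge `e` into a bond edge amounts to flipping it when its target, but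
not its source, is reachable without it. -/
lemma mem_escape_insert_iff {Λ : Set (ℤ × ℤ)} {F : Set Edge} {e : Edge} (he : e ∉ F) (ω : Config) :
    (ω ∈ ReachAvoiding Λ F e (eDst e) \ ReachAvoiding Λ F e (eSrc e) →
      (ω ∈ Escape Λ (insert e F) ↔ flipOn {e} ω ∈ Escape Λ F)) ∧
    (ω ∉ ReachAvoiding Λ F e (eDst e) \ ReachAvoiding Λ F e (eSrc e) →
      (ω ∈ Escape Λ (insert e F) ↔ ω ∈ Escape Λ F)) := by
  set R := HybridStep Λ {e}ᶜ F ω with hR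
  have h1 : HybridStep Λ {e}ᶜ (insert e F) ω = R := by
    have hF : ∀ e' ∈ ({e}ᶜ : Set Edge), e' ∈ insert e F ↔ e' ∈ F := fun e' h =>
      Set.mem_insert_iff.trans (or_iff_right h)
    ext u v
    exact ⟨fun h => h.congr (fun _ _ => rfl) hF, fun h => h.congr (fun _ _ => rfl)
      fun e' h => (hF e' h).symm⟩
  have h2 : HybridStep Λ {e}ᶜ F (flipOn {e} ω) = R := by
    have hω : ∀ e' ∈ edgesAt Λ ∩ {e}ᶜ, flipOn {e} ω e' = ω e' := by
      rintro e' ⟨-, h⟩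
      simpa [flipOn] using h
    ext u v
    exact ⟨fun h => h.congr hω fun _ _ => Iff.rfl,
      fun h => h.congr (fun e' h => (hω e' h).symm) fun _ _ => Iff.rfl⟩
  have hflip : flipOn {e} ω e = !ω e := by simp [flipOn]
  have hins : e ∈ insert e F := Set.mem_insert e F
  simp only [Escape, ReachAvoiding, Set.mem_ofPred_eq, Set.mem_sdiff,
    hybridStep_eq_addArcs Λ _ _ e, h1, h2, ← hR, hflip]
  by_cases ha : ReflTransGen R (0, 0) (eSrc e)
  · refine ⟨fun h => absurd ha h.2, fun _ => ?_⟩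
    exact ⟨fun ⟨v, hv, h⟩ => ⟨v, hv, reflTransGen_addArcs_of_fst ha h⟩,
      fun ⟨v, hv, h⟩ => ⟨v, hv, reflTransGen_addArcs_of_fst ha h⟩⟩
  by_cases hb : ReflTransGen R (0, 0) (eDst e)
  · refine ⟨fun _ => ?_, fun h => absurd ⟨hb, ha⟩ h⟩
    have hq : ((!ω e) = true ↔ e ∈ F) ↔ (ω e = true ↔ e ∈ insert e F) := by
      simp [he]
    simp only [hq]
    exact ⟨fun ⟨v, hv, h⟩ => ⟨v, hv, reflTransGen_addArcs_of_snd hb h⟩,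
      fun ⟨v, hv, h⟩ => ⟨v, hv, reflTransGen_addArcs_of_snd hb h⟩⟩
  · refine ⟨fun h => absurd h.1 hb, fun _ => ?_⟩
    exact ⟨fun ⟨v, hv, h⟩ => ⟨v, hv, reflTransGen_addArcs (reflTransGen_of_addArcs ha hb h)⟩,
      fun ⟨v, hv, h⟩ => ⟨v, hv, reflTransGen_addArcs (reflTransGen_of_addArcs ha hb h)⟩⟩

lemma coins_escape_insert {Λ : Set (ℤ × ℤ)} (hΛ : Λ.Finite) {F : Set Edge} {e : Edge}
    (he : e ∉ F) : coins (Escape Λ (insert e F)) = coins (Escape Λ F) := by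
  set W := ReachAvoiding Λ F e (eDst e) \ ReachAvoiding Λ F e (eSrc e) with hW
  have hdet : DetBy W (edgesAt Λ ∩ {e}ᶜ) :=
    (detBy_reachAvoiding _ _ _ _).inter (detBy_reachAvoiding _ _ _ _).compl
  have hWm : MeasurableSet W :=
    hdet.measurableSet ((finite_edgesAt hΛ).subset Set.inter_subset_left)
  have hEm : MeasurableSet (Escape Λ F) := (detBy_escape Λ F).measurableSet (finite_edgesAt hΛ)
  have hflip : ∀ ω, ∀ e' ∈ edgesAt Λ ∩ {e}ᶜ, ω e' = flipOn {e} ω e' := by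
    rintro ω e' ⟨-, h⟩
    simpa [flipOn] using h
  have h1 : Escape Λ (insert e F) ∩ W = flipOn {e} ⁻¹' (Escape Λ F ∩ W) := by
    ext ω
    have hWω : ω ∈ W ↔ flipOn {e} ω ∈ W :=
      ⟨hdet _ _ (hflip ω), hdet _ _ fun e' h => (hflip ω e' h).symm⟩
    simp only [Set.mem_inter_iff, Set.mem_preimage, ← hWω]
    exact and_congr_left (mem_escape_insert_iff he ω).1
  have h2 : Escape Λ (insert e F) \ W = Escape Λ F \ W := by
    ext ω
    exact and_congr_left (mem_escape_insert_iff he ω).2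
  rw [← measure_inter_add_sdiff (Escape Λ (insert e F)) hWm,
    ← measure_inter_add_sdiff (Escape Λ F) hWm, h1, h2,
    (measurePreserving_flipOn {e}).measure_preimage (hEm.inter hWm).nullMeasurableSet]

lemma coins_escape_eq {Λ : Set (ℤ × ℤ)} (hΛ : Λ.Finite) {F : Set Edge} (hF : F.Finite) :
    coins (Escape Λ F) = coins (Escape Λ ∅) := by
  induction F, hF using Set.Finite.induction_on with
  | empty => rfl
  | insert he _ ih => rw [coins_escape_insert hΛ he, ih]

lemma mem_escape_of_percolates {Λ : Set (ℤ × ℤ)} (hΛ : Λ.Finite) {ω : Config}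
    (h : percolates (gStep ω) Set.univ) : ω ∈ Escape Λ ∅ := by
  classical
  obtain ⟨γ, h0, hinj, hstep, -⟩ := h
  have hex : ∃ n, γ n ∉ Λ := by
    by_contra! hc
    exact Set.infinite_range_of_injective hinj (hΛ.subset (Set.range_subset_iff.2 hc))
  refine ⟨γ (Nat.find hex), Nat.find_spec hex, ?_⟩
  have key : ∀ k ≤ Nat.find hex, ReflTransGen (HybridStep Λ Set.univ ∅ ω) (0, 0) (γ k) := by
    intro k hk
    induction k with
    | zero => rw [h0]
    | succ k ih =>
      refine (ih (by omega)).tail ⟨by simpa using Nat.find_min hex hk, ?_⟩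
      obtain ⟨e, he⟩ := hstep k
      exact ⟨e, trivial, by simpa [Arc] using he⟩
  exact key _ le_rfl

lemma exists_conn_of_mem_escape {Λ : Set (ℤ × ℤ)} {ω : Config} (h : ω ∈ Escape Λ (edgesAt Λ)) :
    ∃ v ∉ Λ, Conn ω Set.univ (0, 0) v := by
  obtain ⟨v, hv, h⟩ := h
  refine ⟨v, hv, ReflTransGen.mono ?_ _ _ h⟩
  rintro u w ⟨hu, e, -, ⟨rfl, rfl, ho⟩ | ⟨rfl, rfl, ho⟩⟩
  · exact ⟨⟨e, Or.inl ⟨rfl, rfl⟩, ho⟩, trivial, trivial⟩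
  · exact ⟨⟨e, Or.inr ⟨rfl, rfl⟩, ho.2 (Or.inr hu)⟩, trivial, trivial⟩

/-- In Grimmett's random-orientation model with parameter `1/2` there is almost
surely no infinite directed self-avoiding path from the origin. -/
theorem thetaG_half_eq_zero : thetaG (1 / 2) = 0 := by
  obtain ⟨c, hc0, hc⟩ := exists_le_coins_blocked
  rw [thetaG, mu_half, ← measureReal_eq_zero_iff]
  have hle : ∀ K : ℕ, coins.real {ω | percolates (gStep ω) Set.univ} ≤ (1 - c) ^ K := by
    intro K
    set Λ := {v | supNorm v ≤ radius K - 1}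
    have hΛ : Λ.Finite := finite_supNorm_le _
    calc coins.real {ω | percolates (gStep ω) Set.univ}
        ≤ coins.real (Escape Λ ∅) := measureReal_mono fun ω h => mem_escape_of_percolates hΛ h
      _ = coins.real (Escape Λ (edgesAt Λ)) := by
        simp only [measureReal_def, coins_escape_eq hΛ (finite_edgesAt hΛ)]
      _ ≤ _ := measureReal_mono fun ω h => by
        obtain ⟨v, hv, hc⟩ := exists_conn_of_mem_escape h
        exact ⟨v, hc, by simpa [Λ] using hv⟩
      _ ≤ _ := coins_conn_le hc K
  have hc1 : c ≤ 1 := (hc 0 le_rfl).trans measureReal_le_one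
  exact le_antisymm (ge_of_tendsto' (tendsto_pow_atTop_nhds_zero_of_lt_one (by linarith)
    (by linarith)) hle) measureReal_nonneg

end RandomOrientation
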